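/- For every λ₀ ∈ Λ and every ε > 0 there exists λ ∈ Λ with |λ − λ₀| ≤ ε such that the map Q*_λ = P_λ + Q has a wandering disc contained in its filled Julia set relative to B which is not attracted to an attracting cycle: there exists a closed ball D ⊆ B such that (1) (Q*_λ)^n(D) ⊆ B for all n ≥ 0; (2) the images (Q*_λ)^n(D), n ≥ 0, are pairwise disjoint; and (3) for every k ≥ 1 and every periodic point z₀ ∈ B with (Q*_λ)^k(z₀) = z₀ and |((Q*_λ)^k)'(z₀)| < 1, no point x ∈ D satisfies min_{0≤j<k} |(Q*_λ)^n(x) − (Q*_λ)^j(z₀)| → 0 as n → ∞. -/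

import Mathlib

open Filter Metric

/-- The polynomial family `P_λ(z) = (λ/p)·z^p + (1 − λ/p)·z^{p+1}`. -/
noncomputable def Pfam {K : Type*} [NontriviallyNormedField K] (p : ℕ) (lam z : K) : K :=
  lam / (p : K) * z ^ p + (1 - lam / (p : K)) * z ^ (p + 1)

/-- Evaluation at `z` of the power series with coefficients `a`. -/
noncomputable def Qser {K : Type*} [NontriviallyNormedField K] (a : ℕ → K) (z : K) : K :=
  ∑' i, a i * z ^ i

/-- The perturbed map `Q*_λ = P_λ + Q`. -/
noncomputable def Qstar {K : Type*} [NontriviallyNormedField K] (p : ℕ) (a : ℕ → K)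
    (lam z : K) : K :=
  Pfam p lam z + Qser a z

section UltrametricHelpers

variable {K : Type*} [NormedField K] [IsUltrametricDist K]

lemma norm_add_le_of_le_of_le {x y : K} {r : ℝ} (hx : ‖x‖ ≤ r) (hy : ‖y‖ ≤ r) : ‖x + y‖ ≤ r :=
  (IsUltrametricDist.norm_add_le_max x y).trans (max_le hx hy)

lemma norm_sub_le_of_le_of_le {x y : K} {r : ℝ} (hx : ‖x‖ ≤ r) (hy : ‖y‖ ≤ r) : ‖x - y‖ ≤ r := by
  rw [sub_eq_add_neg]
  exact norm_add_le_of_le_of_le hx (by rwa [norm_neg])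

lemma norm_sub_le_of_sub_le_of_sub_le {x y z : K} {r : ℝ} (h₁ : ‖x - y‖ ≤ r) (h₂ : ‖y - z‖ ≤ r) :
    ‖x - z‖ ≤ r := by
  rw [← sub_add_sub_cancel x y z]
  exact norm_add_le_of_le_of_le h₁ h₂

lemma norm_add_lt_of_lt_of_lt {x y : K} {r : ℝ} (hx : ‖x‖ < r) (hy : ‖y‖ < r) : ‖x + y‖ < r :=
  (IsUltrametricDist.norm_add_le_max x y).trans_lt (max_lt hx hy)

lemma norm_add_eq_left_of_lt {x y : K} (h : ‖y‖ < ‖x‖) : ‖x + y‖ = ‖x‖ := by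
  rw [IsUltrametricDist.norm_add_eq_max_of_norm_ne_norm h.ne', max_eq_left h.le]

lemma norm_add_eq_right_of_lt {x y : K} (h : ‖x‖ < ‖y‖) : ‖x + y‖ = ‖y‖ := by
  rw [add_comm, norm_add_eq_left_of_lt h]

lemma norm_eq_of_norm_sub_lt {x y : K} (h : ‖x - y‖ < ‖y‖) : ‖x‖ = ‖y‖ := by
  simpa using norm_add_eq_right_of_lt h

lemma norm_pow_sub_pow_le {x y : K} {r : ℝ} (hx : ‖x‖ ≤ r) (hy : ‖y‖ ≤ r) (n : ℕ) :
    ‖x ^ n - y ^ n‖ ≤ r ^ (n - 1) * ‖x - y‖ := by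
  have hr : 0 ≤ r := (norm_nonneg x).trans hx
  rw [← geom_sum₂_mul, norm_mul]
  refine mul_le_mul_of_nonneg_right ?_ (norm_nonneg _)
  refine IsUltrametricDist.norm_sum_le_of_forall_le_of_nonneg (by positivity) fun i hi => ?_
  have hi' : i + (n - 1 - i) = n - 1 := by have := Finset.mem_range.1 hi; omega
  rw [norm_mul, norm_pow, norm_pow, show r ^ (n - 1) = r ^ i * r ^ (n - 1 - i) by rw [← pow_add, hi']]
  exact mul_le_mul (pow_le_pow_left₀ (norm_nonneg _) hx _)
    (pow_le_pow_left₀ (norm_nonneg _) hy _) (by positivity) (by positivity)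

lemma norm_pow_prime_sub_pow_prime_le {p : ℕ} (hp : p.Prime) {x y : K} {r : ℝ} (hy : ‖y‖ ≤ r)
    (hxy : ‖x - y‖ ≤ r) :
    ‖x ^ p - y ^ p‖ ≤ max (‖x - y‖ ^ p) (‖(p : K)‖ * ‖x - y‖ * r ^ (p - 1)) := by
  have hr : 0 ≤ r := (norm_nonneg y).trans hy
  have h := add_pow_prime_eq hp (x - y) y
  rw [sub_add_cancel] at h
  set S := ∑ k ∈ Finset.Ioo 0 p, (x - y) ^ (k - 1) * y ^ (p - k - 1) * ((p.choose k / p : ℕ) : K)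
    with hS
  have hSr : ‖S‖ ≤ r ^ (p - 2) := by
    refine IsUltrametricDist.norm_sum_le_of_forall_le_of_nonneg (by positivity) fun k hk => ?_
    have hk' : (k - 1) + (p - k - 1) = p - 2 := by have := Finset.mem_Ioo.1 hk; omega
    rw [norm_mul, norm_mul, norm_pow, norm_pow, ← hk', pow_add]
    calc ‖x - y‖ ^ (k - 1) * ‖y‖ ^ (p - k - 1) * ‖((p.choose k / p : ℕ) : K)‖
        ≤ r ^ (k - 1) * r ^ (p - k - 1) * 1 := by
          gcongr
          exact IsUltrametricDist.norm_natCast_le_one K _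
      _ = _ := mul_one _
  have h' : x ^ p - y ^ p = (x - y) ^ p + p * (x - y) * y * S := by rw [h]; ring
  rw [h']
  refine (IsUltrametricDist.norm_add_le_max _ _).trans (max_le_max (norm_pow _ _).le ?_)
  have hp2 := hp.two_le
  have hp1 : p - 1 = (p - 2) + 1 := by omega
  rw [norm_mul, norm_mul, norm_mul, hp1, pow_succ, mul_assoc, mul_comm (r ^ (p - 2))]
  gcongr

end UltrametricHelpers

section PolynomialApproximation

variable {K : Type*} [NormedField K]

/-- `E` is bounded on `S` and is there a uniform limit of polynomial functions. -/
def PolyApprox (S : Set K) (E : K → K) : Prop :=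
  (∃ B : ℝ, ∀ z ∈ S, ‖E z‖ ≤ B) ∧
    ∀ δ : ℝ, 0 < δ → ∃ q : Polynomial K, ∀ z ∈ S, ‖E z - q.eval z‖ ≤ δ

namespace PolyApprox

variable {S : Set K} {E G : K → K}

lemma const (c : K) : PolyApprox S fun _ => c :=
  ⟨⟨‖c‖, fun _ _ => le_rfl⟩, fun δ hδ => ⟨Polynomial.C c, fun z _ => by simp [hδ.le]⟩⟩

lemma id (hS : ∃ B : ℝ, ∀ z ∈ S, ‖z‖ ≤ B) : PolyApprox S fun z => z :=
  ⟨hS, fun δ hδ => ⟨Polynomial.X, fun z _ => by simp [hδ.le]⟩⟩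

lemma add (hE : PolyApprox S E) (hG : PolyApprox S G) : PolyApprox S fun z => E z + G z := by
  obtain ⟨⟨B, hB⟩, hE⟩ := hE
  obtain ⟨⟨B', hB'⟩, hG⟩ := hG
  refine ⟨⟨B + B', fun z hz => norm_add_le_of_le (hB z hz) (hB' z hz)⟩, fun δ hδ => ?_⟩
  obtain ⟨q, hq⟩ := hE (δ / 2) (by positivity)
  obtain ⟨q', hq'⟩ := hG (δ / 2) (by positivity)
  refine ⟨q + q', fun z hz => ?_⟩
  rw [Polynomial.eval_add, add_sub_add_comm, ← add_halves δ]
  exact norm_add_le_of_le (hq z hz) (hq' z hz)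

lemma mul (hE : PolyApprox S E) (hG : PolyApprox S G) : PolyApprox S fun z => E z * G z := by
  obtain ⟨⟨B, hB⟩, hE⟩ := hE
  obtain ⟨⟨B', hB'⟩, hG⟩ := hG
  have hb : ∀ z ∈ S, ‖E z‖ ≤ |B| + 1 := fun z hz =>
    (hB z hz).trans ((le_abs_self B).trans (by linarith))
  have hb' : ∀ z ∈ S, ‖G z‖ ≤ |B'| + 1 := fun z hz =>
    (hB' z hz).trans ((le_abs_self B').trans (by linarith))
  have h0 : 0 < |B| + 1 := by positivity
  have h0' : 0 < |B'| + 2 := by positivity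
  refine ⟨⟨(|B| + 1) * (|B'| + 1), fun z hz => by
    rw [norm_mul]; gcongr; exacts [hb z hz, hb' z hz]⟩, fun δ hδ => ?_⟩
  obtain ⟨q, hq⟩ := hE (δ / 2 / (|B'| + 2)) (by positivity)
  obtain ⟨q', hq'⟩ := hG (min 1 (δ / 2 / (|B| + 1))) (by positivity)
  refine ⟨q * q', fun z hz => ?_⟩
  have hq'b : ‖q'.eval z‖ ≤ |B'| + 2 := by
    have h1 := (hq' z hz).trans (min_le_left _ _)
    have h2 := norm_le_norm_add_norm_sub (G z) (q'.eval z)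
    linarith [hb' z hz]
  have h : E z * G z - (q * q').eval z
      = E z * (G z - q'.eval z) + (E z - q.eval z) * q'.eval z := by
    rw [Polynomial.eval_mul]; ring
  rw [h, ← add_halves δ]
  refine norm_add_le_of_le ?_ ?_
  · rw [norm_mul]
    calc ‖E z‖ * ‖G z - q'.eval z‖ ≤ (|B| + 1) * (δ / 2 / (|B| + 1)) := by
          gcongr
          exacts [hb z hz, (hq' z hz).trans (min_le_right _ _)]
      _ = δ / 2 := by field_simp
  · rw [norm_mul]
    calc ‖E z - q.eval z‖ * ‖q'.eval z‖ ≤ (δ / 2 / (|B'| + 2)) * (|B'| + 2) := by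
          gcongr
          exact hq z hz
      _ = δ / 2 := by field_simp

lemma sub (hE : PolyApprox S E) (hG : PolyApprox S G) : PolyApprox S fun z => E z - G z := by
  have := hE.add ((const (-1)).mul hG)
  simpa [sub_eq_add_neg] using this

lemma pow (hE : PolyApprox S E) (n : ℕ) : PolyApprox S fun z => E z ^ n := by
  induction n with
  | zero => simpa using const (1 : K)
  | succ n ih => simpa [pow_succ] using ih.mul hE

lemma eval (hE : PolyApprox S E) (q : Polynomial K) : PolyApprox S fun z => q.eval (E z) := by
  induction q using Polynomial.induction_on' with
  | add q₁ q₂ h₁ h₂ => simpa using h₁.add h₂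
  | monomial n c => simpa using (const c).mul (hE.pow n)

lemma of_uniform_limit
    (h : ∀ δ : ℝ, 0 < δ → ∃ G : K → K, PolyApprox S G ∧ ∀ z ∈ S, ‖E z - G z‖ ≤ δ) :
    PolyApprox S E := by
  refine ⟨?_, fun δ hδ => ?_⟩
  · obtain ⟨G, ⟨⟨B, hB⟩, -⟩, hG⟩ := h 1 one_pos
    refine ⟨B + 1, fun z hz => ?_⟩
    rw [← add_sub_cancel (G z) (E z)]
    exact norm_add_le_of_le (hB z hz) (hG z hz)
  · obtain ⟨G, hG, hEG⟩ := h (δ / 2) (by positivity)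
    obtain ⟨q, hq⟩ := hG.2 (δ / 2) (by positivity)
    refine ⟨q, fun z hz => ?_⟩
    rw [← sub_add_sub_cancel (E z) (G z), ← add_halves δ]
    exact norm_add_le_of_le (hEG z hz) (hq z hz)

end PolyApprox

variable [IsUltrametricDist K]

lemma norm_prod_sub_prod_lt_of_dist_lt (m : Multiset K) {c z : K}
    (h : ∀ r ∈ m, ‖z - c‖ < ‖c - r‖) :
    ‖(m.map fun r => z - r).prod - (m.map fun r => c - r).prod‖
      < ‖(m.map fun r => c - r).prod‖ := by
  induction m using Multiset.induction_on with
  | empty => simp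
  | cons r m ih =>
    have hr := h r (Multiset.mem_cons_self r m)
    have hm := ih fun r' hr' => h r' (Multiset.mem_cons_of_mem hr')
    have hzr : ‖z - r‖ = ‖c - r‖ := norm_eq_of_norm_sub_lt (by simpa using hr)
    have hcr : 0 < ‖c - r‖ := (norm_nonneg _).trans_lt hr
    simp only [Multiset.map_cons, Multiset.prod_cons]
    set a := (m.map fun r => z - r).prod
    set b := (m.map fun r => c - r).prod
    have hb : 0 < ‖b‖ := (norm_nonneg _).trans_lt hm
    have : (z - r) * a - (c - r) * b = (z - r) * (a - b) + (z - c) * b := by ring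
    rw [this, norm_mul (c - r)]
    refine norm_add_lt_of_lt_of_lt ?_ ?_
    · rw [norm_mul, hzr]; gcongr
    · rw [norm_mul]; gcongr

variable [IsAlgClosed K]

lemma Polynomial.exists_root_of_norm_eval_le (q : Polynomial K) {c z : K}
    (hne : q.eval z ≠ q.eval c) (h : ‖q.eval c‖ ≤ ‖q.eval z - q.eval c‖) :
    ∃ r, ‖r - c‖ ≤ ‖z - c‖ ∧ q.eval r = 0 := by
  by_contra! hcon
  have hq : q ≠ 0 := by rintro rfl; simp at hne
  have hroots : ∀ r ∈ q.roots, ‖z - c‖ < ‖c - r‖ := fun r hr => by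
    by_contra! hle
    exact hcon r (by rwa [norm_sub_rev]) ((Polynomial.mem_roots hq).1 hr)
  have key := norm_prod_sub_prod_lt_of_dist_lt q.roots hroots
  have hs := (IsAlgClosed.splits q).eval_eq_prod_roots
  rw [hs z, hs c, ← mul_sub, norm_mul, norm_mul] at h
  have hl : 0 < ‖q.leadingCoeff‖ := by simpa using hq
  exact absurd (le_of_mul_le_mul_left h hl) (not_le.2 key)

/-- A uniform limit of polynomials on a disc that moves the centre far enough comes arbitrarily
close to the prescribed value `w`. -/
lemma PolyApprox.exists_norm_sub_lt {E : K → K} {c : K} {s : ℝ}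
    (hE : PolyApprox (closedBall c s) E) {z : K} (hz : z ∈ closedBall c s) (w : K)
    (h : ‖E c - w‖ ≤ ‖E z - E c‖) {δ : ℝ} (hδ : 0 < δ) :
    ∃ y ∈ closedBall c s, ‖E y - w‖ < δ := by
  rw [mem_closedBall, dist_eq_norm] at hz
  have hc : c ∈ closedBall c s := mem_closedBall_self ((norm_nonneg _).trans hz)
  by_cases hEz : E z = E c
  · refine ⟨c, hc, ?_⟩
    rw [hEz, sub_self, norm_zero] at h
    exact h.trans_lt hδ
  have hD : 0 < ‖E z - E c‖ := norm_pos_iff.2 (sub_ne_zero.2 hEz)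
  obtain ⟨q, hq⟩ := hE.2 (min (δ / 2) (‖E z - E c‖ / 2)) (by positivity)
  have hqz := (hq z (by rwa [mem_closedBall, dist_eq_norm])).trans (min_le_right _ _)
  have hqc := (hq c hc).trans (min_le_right _ _)
  have hlt : ‖E z - E c‖ / 2 < ‖E z - E c‖ := by linarith
  have hdiff : ‖q.eval z - q.eval c‖ = ‖E z - E c‖ := by
    refine norm_eq_of_norm_sub_lt (lt_of_le_of_lt ?_ hlt)
    have : q.eval z - q.eval c - (E z - E c) = (E c - q.eval c) - (E z - q.eval z) := by ring
    rw [this]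
    exact norm_sub_le_of_le_of_le hqc hqz
  have hcw : ‖q.eval c - w‖ ≤ ‖E z - E c‖ := by
    refine norm_sub_le_of_sub_le_of_sub_le (y := E c) ?_ h
    rw [norm_sub_rev]
    exact hqc.trans hlt.le
  obtain ⟨y, hy, hy0⟩ := (q - Polynomial.C w).exists_root_of_norm_eval_le (c := c) (z := z)
    (by
      simp only [Polynomial.eval_sub, Polynomial.eval_C, ne_eq, sub_left_inj]
      rw [← sub_eq_zero, ← norm_eq_zero, hdiff]
      exact hD.ne')
    (by simpa [hdiff] using hcw)
  have hys : y ∈ closedBall c s := by rw [mem_closedBall, dist_eq_norm]; exact hy.trans hz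
  refine ⟨y, hys, ?_⟩
  have hqy : q.eval y = w := by simpa [sub_eq_zero] using hy0
  rw [← hqy]
  exact ((hq y hys).trans (min_le_left _ _)).trans_lt (by linarith)

end PolynomialApproximation

section PerturbedFamily

variable {K : Type*} [NontriviallyNormedField K]

/-- The map `P_λ + Q` for an arbitrary function `Q`. -/
noncomputable def pertMap (p : ℕ) (Q : K → K) (lam z : K) : K :=
  Pfam p lam z + Q z

lemma Pfam_eq_pow_mul (p : ℕ) (lam z : K) :
    Pfam p lam z = z ^ p * (lam / p * (1 - z) + z) := by
  rw [Pfam, pow_succ]; ring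

/-- The properties of a perturbation `Q` on the closed unit disc that are used below: it is
bounded by and Lipschitz with a constant `C < ρ`, and it is a uniform limit of polynomials. -/
structure SmallPert (p : ℕ) (Q : K → K) (C ρ : ℝ) : Prop where
  prime : p.Prime
  norm_p : ‖(p : K)‖ = (p : ℝ)⁻¹
  C_nonneg : 0 ≤ C
  C_lt : C < ρ
  rho_lt_one : ρ < 1
  rho_pow : p * ρ ^ p = ρ
  inv_le_rho : (p : ℝ)⁻¹ ≤ ρ
  bound : ∀ z, ‖z‖ ≤ 1 → ‖Q z‖ ≤ C
  lip : ∀ z w, ‖z‖ ≤ 1 → ‖w‖ ≤ 1 → ‖Q z - Q w‖ ≤ C * ‖z - w‖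
  approx : ∀ δ : ℝ, 0 < δ → ∃ q : Polynomial K, ∀ z, ‖z‖ ≤ 1 → ‖Q z - q.eval z‖ ≤ δ

namespace SmallPert

variable {p : ℕ} {Q : K → K} {C ρ : ℝ}

lemma one_lt_p (h : SmallPert p Q C ρ) : (1 : ℝ) < p := by exact_mod_cast h.prime.one_lt

lemma p_pos (h : SmallPert p Q C ρ) : (0 : ℝ) < p := one_pos.trans h.one_lt_p

lemma inv_pos (h : SmallPert p Q C ρ) : 0 < (p : ℝ)⁻¹ := _root_.inv_pos.2 h.p_pos

lemma inv_lt_one (h : SmallPert p Q C ρ) : (p : ℝ)⁻¹ < 1 := inv_lt_one_of_one_lt₀ h.one_lt_p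

lemma rho_pos (h : SmallPert p Q C ρ) : 0 < ρ := h.inv_pos.trans_le h.inv_le_rho

lemma p_ne_zero (h : SmallPert p Q C ρ) : (p : K) ≠ 0 := by
  rw [← norm_pos_iff, h.norm_p]; exact h.inv_pos

lemma rho_lt_mul_pow (h : SmallPert p Q C ρ) {r : ℝ} (hr : ρ < r) : ρ < p * r ^ p := by
  have := h.p_pos
  have h1 := pow_lt_pow_left₀ hr h.rho_pos.le h.prime.ne_zero
  calc ρ = p * ρ ^ p := h.rho_pow.symm
    _ < p * r ^ p := by gcongr

lemma Pfam_sub (lam z w : K) :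
    Pfam p lam z - Pfam p lam w = lam / p * ((z ^ p - w ^ p) * (1 - z)) - lam / p * (w ^ p * (z - w))
      + (z ^ (p + 1) - w ^ (p + 1)) := by
  rw [Pfam, Pfam]; ring

lemma norm_map_sub_map (h : SmallPert p Q C ρ) (lam mu z : K) :
    ‖pertMap p Q lam z - pertMap p Q mu z‖ = ‖lam - mu‖ * (p * ‖z‖ ^ p * ‖1 - z‖) := by
  have : pertMap p Q lam z - pertMap p Q mu z = (lam - mu) * ((p : K)⁻¹ * z ^ p * (1 - z)) := by
    simp only [pertMap, Pfam]; ring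
  rw [this, norm_mul, norm_mul, norm_mul, norm_inv, h.norm_p, inv_inv, norm_pow]

lemma norm_map_one_sub_one_le (h : SmallPert p Q C ρ) (lam : K) :
    ‖pertMap p Q lam 1 - 1‖ ≤ 1 := by
  have : pertMap p Q lam 1 - 1 = Q 1 := by simp only [pertMap, Pfam]; ring
  rw [this]
  exact (h.bound 1 (by simp)).trans (h.C_lt.trans h.rho_lt_one).le

variable [IsUltrametricDist K]

lemma norm_eq_one {lam : K} (hl : ‖lam - 1‖ < 1) : ‖lam‖ = 1 := by
  simpa using norm_eq_of_norm_sub_lt (x := lam) (y := 1) (by simpa using hl)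

lemma norm_lam_div (h : SmallPert p Q C ρ) {lam : K} (hl : ‖lam - 1‖ < 1) :
    ‖lam / p‖ = p := by
  rw [norm_div, norm_eq_one hl, h.norm_p, one_div, inv_inv]

lemma norm_Pfam (h : SmallPert p Q C ρ) {lam z : K} (hl : ‖lam - 1‖ < 1) (hz : ‖z‖ < 1) :
    ‖Pfam p lam z‖ = p * ‖z‖ ^ p := by
  have h1 : ‖(1 : K) - z‖ = 1 := by
    rw [← norm_one (α := K)]
    exact norm_eq_of_norm_sub_lt (x := 1 - z) (y := (1 : K)) (by simpa using hz)
  have h2 : ‖lam / p * (1 - z)‖ = p := by rw [norm_mul, h.norm_lam_div hl, h1, mul_one]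
  rw [Pfam_eq_pow_mul, norm_mul, norm_pow, norm_add_eq_left_of_lt, h2, mul_comm]
  rw [h2]
  exact hz.trans h.one_lt_p

lemma norm_map (h : SmallPert p Q C ρ) {lam z : K} (hl : ‖lam - 1‖ < 1) (hρ : ρ < ‖z‖)
    (hz : ‖z‖ < 1) : ‖pertMap p Q lam z‖ = p * ‖z‖ ^ p := by
  rw [pertMap, norm_add_eq_left_of_lt, h.norm_Pfam hl hz]
  rw [h.norm_Pfam hl hz]
  exact ((h.bound z hz.le).trans_lt h.C_lt).trans (h.rho_lt_mul_pow hρ)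

lemma norm_map_lt (h : SmallPert p Q C ρ) {lam z : K} {r : ℝ} (hl : ‖lam - 1‖ < 1) (hρ : ρ < r)
    (hr : r ≤ 1) (hz : ‖z‖ < r) : ‖pertMap p Q lam z‖ < p * r ^ p := by
  have hz1 := hz.trans_le hr
  have := h.p_pos
  refine norm_add_lt_of_lt_of_lt ?_
    (((h.bound z hz1.le).trans_lt h.C_lt).trans (h.rho_lt_mul_pow hρ))
  rw [h.norm_Pfam hl hz1]
  have := pow_lt_pow_left₀ hz (norm_nonneg z) h.prime.ne_zero
  gcongr

lemma norm_map_sub_le (h : SmallPert p Q C ρ) {lam z w : K} (hl : ‖lam - 1‖ < 1)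
    (hz : ‖z‖ ≤ 1) (hw : ‖w‖ ≤ 1) :
    ‖pertMap p Q lam z - pertMap p Q lam w‖ ≤ p * ‖z - w‖ := by
  have hp := h.p_pos
  have h1 : ∀ n, ‖z ^ n - w ^ n‖ ≤ ‖z - w‖ := fun n => by
    simpa using norm_pow_sub_pow_le hz hw n
  have h2 : ‖z - w‖ ≤ p * ‖z - w‖ := le_mul_of_one_le_left (norm_nonneg _) h.one_lt_p.le
  have h3 : ‖1 - z‖ ≤ 1 := norm_sub_le_of_le_of_le (by simp) hz
  rw [pertMap, pertMap, add_sub_add_comm, Pfam_sub]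
  refine norm_add_le_of_le_of_le (norm_add_le_of_le_of_le (norm_sub_le_of_le_of_le ?_ ?_)
    ((h1 _).trans h2)) ((h.lip z w hz hw).trans ?_)
  · rw [norm_mul, h.norm_lam_div hl, norm_mul]
    have := mul_le_mul (h1 p) h3 (norm_nonneg _) (norm_nonneg _)
    rw [mul_one] at this
    gcongr
  · rw [norm_mul, h.norm_lam_div hl, norm_mul, norm_pow]
    have := mul_le_of_le_one_left (norm_nonneg (z - w)) (pow_le_one₀ (n := p) (norm_nonneg w) hw)
    gcongr
  · have := h.C_lt.trans (h.rho_lt_one.trans h.one_lt_p)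
    gcongr

lemma norm_map_sub_le_of_rho_lt (h : SmallPert p Q C ρ) {lam z w : K} {r : ℝ}
    (hl : ‖lam - 1‖ < 1) (hρ : ρ < r) (hr : r < 1) (hz : ‖z‖ ≤ r) (hw : ‖w‖ ≤ r)
    (hzw : ‖z - w‖ ≤ (p : ℝ)⁻¹ ^ 2) :
    ‖pertMap p Q lam z - pertMap p Q lam w‖ ≤ p * r ^ p * ‖z - w‖ := by
  have hp := h.p_pos
  have hp2 := h.prime.two_le
  have hr0 : 0 < r := h.rho_pos.trans hρ
  have hinv : (p : ℝ)⁻¹ ≤ r := h.inv_le_rho.trans hρ.le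
  have hpp : p - 1 + 1 = p := by omega
  have hd : 0 ≤ ‖z - w‖ := norm_nonneg _
  have hrp : 0 < r ^ p := by positivity
  have hinvrp : (p : ℝ)⁻¹ * ρ ≤ r ^ p := by
    rw [inv_mul_le_iff₀ hp]
    exact (h.rho_lt_mul_pow hρ).le
  have hinv1 := h.inv_lt_one.le
  have hinv0 := h.inv_pos.le
  have hsq : (p : ℝ)⁻¹ ^ 2 ≤ (p : ℝ)⁻¹ * ρ := by
    rw [sq]; have := h.inv_le_rho; gcongr
  have hsq1 : ‖z - w‖ ≤ 1 := hzw.trans (pow_le_one₀ hinv0 hinv1)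
  have h1 : ‖z ^ p - w ^ p‖ ≤ r ^ p * ‖z - w‖ := by
    refine (norm_pow_prime_sub_pow_prime_le h.prime hw
      (norm_sub_le_of_le_of_le hz hw)).trans (max_le ?_ ?_)
    · conv_lhs => rw [← hpp, pow_succ]
      have : ‖z - w‖ ^ (p - 1) ≤ r ^ p :=
        calc ‖z - w‖ ^ (p - 1) ≤ ‖z - w‖ ^ 1 :=
              pow_le_pow_of_le_one hd hsq1 (by omega)
          _ ≤ _ := by rw [pow_one]; exact hzw.trans (hsq.trans hinvrp)
      gcongr
    · rw [h.norm_p]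
      calc (p : ℝ)⁻¹ * ‖z - w‖ * r ^ (p - 1) ≤ r * ‖z - w‖ * r ^ (p - 1) := by gcongr
        _ = r ^ (p - 1 + 1) * ‖z - w‖ := by ring
        _ = _ := by rw [hpp]
  have h3 : ‖1 - z‖ ≤ 1 := norm_sub_le_of_le_of_le (by simp) (hz.trans hr.le)
  rw [pertMap, pertMap, add_sub_add_comm, Pfam_sub]
  refine norm_add_le_of_le_of_le (norm_add_le_of_le_of_le (norm_sub_le_of_le_of_le ?_ ?_) ?_)
    ((h.lip z w (hz.trans hr.le) (hw.trans hr.le)).trans ?_)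
  · rw [norm_mul, h.norm_lam_div hl, norm_mul, mul_assoc]
    have := mul_le_mul h1 h3 (norm_nonneg _) (by positivity)
    rw [mul_one] at this
    gcongr
  · rw [norm_mul, h.norm_lam_div hl, norm_mul, norm_pow, mul_assoc]
    gcongr
  · refine (norm_pow_sub_pow_le hz hw (p + 1)).trans ?_
    rw [Nat.add_sub_cancel]
    have := le_mul_of_one_le_left hrp.le h.one_lt_p.le
    gcongr
  · have := (h.C_lt.trans (h.rho_lt_mul_pow hρ)).le
    gcongr

lemma norm_eq_one_of_sub_one (h : SmallPert p Q C ρ) {z : K} (hz : ‖z - 1‖ ≤ (p : ℝ)⁻¹) :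
    ‖z‖ = 1 :=
  norm_eq_one (hz.trans_lt h.inv_lt_one)

lemma norm_map_sub_add_le (h : SmallPert p Q C ρ) {lam z w : K} (hl : ‖lam - 1‖ < 1)
    (hz : ‖z - 1‖ ≤ (p : ℝ)⁻¹) (hw : ‖w - 1‖ ≤ (p : ℝ)⁻¹) :
    ‖pertMap p Q lam z - pertMap p Q lam w + lam / p * (z - w)‖ ≤ ‖z - w‖ := by
  have hp := h.p_pos
  have hz1 := (h.norm_eq_one_of_sub_one hz).le
  have hw1 := (h.norm_eq_one_of_sub_one hw).le
  have h1 : ∀ n, ‖z ^ n - w ^ n‖ ≤ ‖z - w‖ := fun n => by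
    simpa using norm_pow_sub_pow_le hz1 hw1 n
  have h4 : ‖1 - w ^ p‖ ≤ (p : ℝ)⁻¹ := by
    have := norm_pow_sub_pow_le (x := 1) (y := w) (r := 1) (by simp) hw1 p
    rw [one_pow, one_pow, one_mul, norm_sub_rev 1 w] at this
    exact this.trans hw
  have : pertMap p Q lam z - pertMap p Q lam w + lam / p * (z - w)
      = lam / p * ((z ^ p - w ^ p) * (1 - z)) + lam / p * ((1 - w ^ p) * (z - w))
      + (z ^ (p + 1) - w ^ (p + 1)) + (Q z - Q w) := by
    rw [pertMap, pertMap, add_sub_add_comm, Pfam_sub]; ring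
  rw [this]
  have key : ‖z - w‖ = p * ((p : ℝ)⁻¹ * ‖z - w‖) := by rw [mul_inv_cancel_left₀ hp.ne']
  refine norm_add_le_of_le_of_le (norm_add_le_of_le_of_le (norm_add_le_of_le_of_le ?_ ?_)
    (h1 _)) ((h.lip z w hz1 hw1).trans ?_)
  · rw [norm_mul, h.norm_lam_div hl, norm_mul, norm_sub_rev 1 z, mul_comm ‖z ^ p - w ^ p‖]
    refine le_of_le_of_eq ?_ key.symm
    have := h1 p
    gcongr
  · rw [norm_mul, h.norm_lam_div hl, norm_mul]
    refine le_of_le_of_eq ?_ key.symm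
    gcongr
  · exact mul_le_of_le_one_left (norm_nonneg _) (h.C_lt.trans h.rho_lt_one).le

lemma norm_map_sub_eq (h : SmallPert p Q C ρ) {lam z w : K} (hl : ‖lam - 1‖ < 1)
    (hz : ‖z - 1‖ ≤ (p : ℝ)⁻¹) (hw : ‖w - 1‖ ≤ (p : ℝ)⁻¹) :
    ‖pertMap p Q lam z - pertMap p Q lam w‖ = p * ‖z - w‖ := by
  rcases eq_or_ne z w with rfl | hne
  · simp
  have hd : 0 < ‖z - w‖ := norm_pos_iff.2 (sub_ne_zero.2 hne)
  have h1 : ‖-(lam / p * (z - w))‖ = p * ‖z - w‖ := by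
    rw [norm_neg, norm_mul, h.norm_lam_div hl]
  rw [← h1]
  refine norm_eq_of_norm_sub_lt ?_
  rw [h1, sub_neg_eq_add]
  exact (h.norm_map_sub_add_le hl hz hw).trans_lt (lt_mul_of_one_lt_left hd h.one_lt_p)

end SmallPert

lemma PolyApprox.pertMap [IsUltrametricDist K] {p : ℕ} {Q : K → K} {C ρ : ℝ}
    (h : SmallPert p Q C ρ) {S : Set K} {l g : K → K} (hl : PolyApprox S l) (hg : PolyApprox S g)
    (hg1 : ∀ z ∈ S, ‖g z‖ ≤ 1) : PolyApprox S fun z => pertMap p Q (l z) (g z) := by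
  have hQ : PolyApprox S fun z => Q (g z) := PolyApprox.of_uniform_limit fun δ hδ => by
    obtain ⟨q, hq⟩ := h.approx δ hδ
    exact ⟨_, hg.eval q, fun z hz => hq _ (hg1 z hz)⟩
  have := (((hl.mul (const (p : K)⁻¹)).mul (hg.pow p)).add
    (((const 1).sub (hl.mul (const (p : K)⁻¹))).mul (hg.pow (p + 1)))).add hQ
  simpa only [_root_.pertMap, Pfam, div_eq_mul_inv] using this

end PerturbedFamily

section FixedPointAndRadii

variable {K : Type*} [NontriviallyNormedField K] {p : ℕ} {Q : K → K} {C ρ : ℝ}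

/-- An iteration whose limit is the fixed point of `pertMap p Q lam` close to `1`. -/
noncomputable def fixStep (p : ℕ) (Q : K → K) (lam z : K) : K :=
  z + p * (pertMap p Q lam z - z)

namespace SmallPert

variable [IsUltrametricDist K]

lemma norm_fixStep_sub_le (h : SmallPert p Q C ρ) {lam z w : K} {θ : ℝ} (hθ : (p : ℝ)⁻¹ ≤ θ)
    (hθ1 : θ < 1) (hl : ‖lam - 1‖ ≤ θ) (hz : ‖z - 1‖ ≤ (p : ℝ)⁻¹) (hw : ‖w - 1‖ ≤ (p : ℝ)⁻¹) :
    ‖fixStep p Q lam z - fixStep p Q lam w‖ ≤ θ * ‖z - w‖ := by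
  have h0 := h.p_ne_zero
  have : fixStep p Q lam z - fixStep p Q lam w
      = -((lam - 1) * (z - w))
        + p * ((pertMap p Q lam z - pertMap p Q lam w + lam / p * (z - w)) - (z - w)) := by
    simp only [fixStep]; field_simp; ring
  rw [this]
  refine norm_add_le_of_le_of_le ?_ ?_
  · rw [norm_neg, norm_mul]; gcongr
  · rw [norm_mul, h.norm_p]
    have := norm_sub_le_of_le_of_le (h.norm_map_sub_add_le (hl.trans_lt hθ1) hz hw) le_rfl
    have := h.inv_pos.le.trans hθ
    gcongr

lemma norm_fixStep_sub_one_le (h : SmallPert p Q C ρ) {lam z : K} {θ : ℝ} (hθ : (p : ℝ)⁻¹ ≤ θ)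
    (hθ1 : θ < 1) (hl : ‖lam - 1‖ ≤ θ) (hz : ‖z - 1‖ ≤ (p : ℝ)⁻¹) :
    ‖fixStep p Q lam z - 1‖ ≤ (p : ℝ)⁻¹ := by
  have h1 := h.inv_pos.le
  refine norm_sub_le_of_sub_le_of_sub_le (y := fixStep p Q lam 1) ?_ ?_
  · refine (h.norm_fixStep_sub_le hθ hθ1 hl hz (by simp)).trans ?_
    exact (mul_le_of_le_one_left (norm_nonneg _) hθ1.le).trans hz
  · rw [fixStep, add_sub_cancel_left, norm_mul, h.norm_p]
    exact mul_le_of_le_one_right h1 (h.norm_map_one_sub_one_le lam)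

lemma norm_fixStep_iterate_sub_one_le (h : SmallPert p Q C ρ) {lam : K} {θ : ℝ}
    (hθ : (p : ℝ)⁻¹ ≤ θ) (hθ1 : θ < 1) (hl : ‖lam - 1‖ ≤ θ) (m : ℕ) :
    ‖(fixStep p Q lam)^[m] 1 - 1‖ ≤ (p : ℝ)⁻¹ := by
  induction m with
  | zero => simp
  | succ m ih =>
    rw [Function.iterate_succ_apply']
    exact h.norm_fixStep_sub_one_le hθ hθ1 hl ih

lemma exists_fixedPoint [CompleteSpace K] (h : SmallPert p Q C ρ) {lam : K} {θ : ℝ}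
    (hθ : (p : ℝ)⁻¹ ≤ θ) (hθ1 : θ < 1) (hl : ‖lam - 1‖ ≤ θ) :
    ∃ b : K, ‖b - 1‖ ≤ (p : ℝ)⁻¹ ∧ pertMap p Q lam b = b := by
  have h0 : 0 ≤ θ := h.inv_pos.le.trans hθ
  have hmaps : Set.MapsTo (fixStep p Q lam) (closedBall 1 (p : ℝ)⁻¹) (closedBall 1 (p : ℝ)⁻¹) :=
    fun z hz => by
      rw [mem_closedBall, dist_eq_norm] at hz ⊢
      exact h.norm_fixStep_sub_one_le hθ hθ1 hl hz
  have hcontr : ContractingWith ⟨θ, h0⟩ (hmaps.restrict _ _ _) := by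
    refine ⟨by exact_mod_cast hθ1, LipschitzWith.of_dist_le_mul fun z w => ?_⟩
    have hz := z.2
    have hw := w.2
    rw [mem_closedBall, dist_eq_norm] at hz hw
    rw [Subtype.dist_eq, Subtype.dist_eq, dist_eq_norm, dist_eq_norm]
    exact h.norm_fixStep_sub_le hθ hθ1 hl hz hw
  obtain ⟨b, hb, hfix, -⟩ := hcontr.exists_fixedPoint' isClosed_closedBall.isComplete hmaps
    (mem_closedBall_self h.inv_pos.le) (edist_ne_top _ _)
  rw [mem_closedBall, dist_eq_norm] at hb
  refine ⟨b, hb, ?_⟩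
  have : (p : K) * (pertMap p Q lam b - b) = 0 := by
    simpa [Function.IsFixedPt, fixStep] using hfix
  exact sub_eq_zero.1 ((mul_eq_zero.1 this).resolve_left h.p_ne_zero)

lemma norm_fixStep_iterate_sub_le (h : SmallPert p Q C ρ) {lam b : K} {θ : ℝ}
    (hθ : (p : ℝ)⁻¹ ≤ θ) (hθ1 : θ < 1) (hl : ‖lam - 1‖ ≤ θ) (hb : ‖b - 1‖ ≤ (p : ℝ)⁻¹)
    (hfix : pertMap p Q lam b = b) (m : ℕ) : ‖(fixStep p Q lam)^[m] 1 - b‖ ≤ θ ^ m := by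
  have h0 : 0 ≤ θ := h.inv_pos.le.trans hθ
  induction m with
  | zero => simpa [norm_sub_rev] using hb.trans h.inv_lt_one.le
  | succ m ih =>
    have hb' : fixStep p Q lam b = b := by simp [fixStep, hfix]
    rw [Function.iterate_succ_apply', pow_succ', ← hb']
    refine (h.norm_fixStep_sub_le hθ hθ1 hl
      (h.norm_fixStep_iterate_sub_one_le hθ hθ1 hl m) hb).trans ?_
    gcongr

lemma polyApprox_fixStep_iterate (h : SmallPert p Q C ρ) {S : Set K} {θ : ℝ}
    (hθ : (p : ℝ)⁻¹ ≤ θ) (hθ1 : θ < 1) (hS : ∀ lam ∈ S, ‖lam - 1‖ ≤ θ) (m : ℕ) :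
    PolyApprox S fun lam => (fixStep p Q lam)^[m] 1 := by
  have hid : PolyApprox S fun lam => lam :=
    PolyApprox.id ⟨1, fun lam hl => (norm_eq_one ((hS lam hl).trans_lt hθ1)).le⟩
  induction m with
  | zero => simpa using PolyApprox.const (1 : K)
  | succ m ih =>
    have h1 : ∀ lam ∈ S, ‖(fixStep p Q lam)^[m] 1‖ ≤ 1 := fun lam hl =>
      (h.norm_eq_one_of_sub_one (h.norm_fixStep_iterate_sub_one_le hθ hθ1 (hS lam hl) m)).le
    simp only [Function.iterate_succ_apply']
    exact ih.add ((PolyApprox.const (p : K)).mul ((PolyApprox.pertMap h hid ih h1).sub ih))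

lemma polyApprox_iterate (h : SmallPert p Q C ρ) {S : Set K} {x : K} {n : ℕ}
    (hS : ∀ lam ∈ S, ‖lam - 1‖ < 1)
    (hx : ∀ lam ∈ S, ∀ j < n, ‖(pertMap p Q lam)^[j] x‖ ≤ 1) :
    PolyApprox S fun lam => (pertMap p Q lam)^[n] x := by
  have hid : PolyApprox S fun lam => lam :=
    PolyApprox.id ⟨1, fun lam hl => (norm_eq_one (hS lam hl)).le⟩
  induction n with
  | zero => simpa using PolyApprox.const x
  | succ n ih =>
    simp only [Function.iterate_succ_apply']
    exact PolyApprox.pertMap h hid (ih fun lam hl j hj => hx lam hl j (hj.trans n.lt_succ_self))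
      fun lam hl => hx lam hl n n.lt_succ_self

lemma norm_fixedPoint_sub_le (h : SmallPert p Q C ρ) {lam mu b c : K}
    (hl : ‖lam - 1‖ < 1) (hb : ‖b - 1‖ ≤ (p : ℝ)⁻¹) (hc : ‖c - 1‖ ≤ (p : ℝ)⁻¹)
    (hfb : pertMap p Q lam b = b) (hfc : pertMap p Q mu c = c) : ‖b - c‖ ≤ ‖lam - mu‖ := by
  have hp := h.p_pos
  by_contra! hlt
  have h1 := h.norm_map_sub_eq hl hb hc
  have h2 : ‖pertMap p Q lam c - pertMap p Q mu c‖ ≤ ‖lam - mu‖ := by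
    rw [h.norm_map_sub_map, h.norm_eq_one_of_sub_one hc, one_pow, mul_one, norm_sub_rev 1 c]
    refine mul_le_of_le_one_right (norm_nonneg _) ?_
    calc (p : ℝ) * ‖c - 1‖ ≤ p * (p : ℝ)⁻¹ := by gcongr
      _ = 1 := mul_inv_cancel₀ hp.ne'
  have h3 : (pertMap p Q lam b - pertMap p Q lam c) + (pertMap p Q lam c - pertMap p Q mu c)
      = b - c := by rw [hfb, hfc]; ring
  have h0 : 0 < ‖b - c‖ := (norm_nonneg _).trans_lt hlt
  have h4 : ‖b - c‖ < p * ‖b - c‖ := lt_mul_of_one_lt_left h0 h.one_lt_p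
  have h5 := norm_add_eq_left_of_lt (x := pertMap p Q lam b - pertMap p Q lam c)
    (y := pertMap p Q lam c - pertMap p Q mu c) (by rw [h1]; exact (h2.trans_lt hlt).trans h4)
  rw [h3, h1] at h5
  exact h4.ne h5

end SmallPert

/-- Moduli of points that reach the unit circle in exactly `i` steps. -/
structure EscapeRadii (K : Type*) [NontriviallyNormedField K] (p : ℕ) (ρ : ℝ) (R : ℕ → ℝ) :
    Prop where
  zero : R 0 = 1
  succ : ∀ i, p * R (i + 1) ^ p = R i
  rho_lt : ∀ i, ρ < R i
  le_one_radius : ∀ i, R (i + 1) ≤ R 1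
  one_lt_one : R 1 < 1
  attained : ∀ i, ∃ v : K, ‖v‖ = R i

lemma SmallPert.exists_escapeRadii [IsAlgClosed K] (h : SmallPert p Q C ρ) :
    ∃ R, EscapeRadii K p ρ R := by
  have hp := h.p_pos
  choose g hg using fun x : K => IsAlgClosed.exists_pow_nat_eq x h.prime.pos
  let u : ℕ → K := fun n => n.rec 1 fun _ v => g (p * v)
  have hu : ∀ i, (p : ℝ) * ‖u (i + 1)‖ ^ p = ‖u i‖ := fun i => by
    have : u (i + 1) ^ p = p * u i := hg _
    rw [← norm_pow, this, norm_mul, h.norm_p, mul_inv_cancel_left₀ hp.ne']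
  have hρ : ∀ i, ρ < ‖u i‖ := fun i => by
    induction i with
    | zero => simpa [u] using h.rho_lt_one
    | succ i ih =>
      refine lt_of_pow_lt_pow_left₀ p (norm_nonneg _) ?_
      rw [← hu i] at ih
      conv_lhs at ih => rw [← h.rho_pow]
      exact lt_of_mul_lt_mul_left ih hp.le
  have hlt : ∀ i, ‖u i‖ ≤ 1 → ‖u (i + 1)‖ < 1 := fun i hi => by
    by_contra! hle
    have h1 := one_le_pow₀ (n := p) hle
    have h2 := hu i
    nlinarith [h.one_lt_p]
  have hle : ∀ i, ‖u i‖ ≤ 1 := fun i => by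
    induction i with
    | zero => simp [u]
    | succ i ih => exact (hlt i ih).le
  refine ⟨fun i => ‖u i‖, ⟨by simp [u], hu, hρ, fun i => ?_, hlt 0 (hle 0), fun i => ⟨u i, rfl⟩⟩⟩
  refine le_of_pow_le_pow_left₀ h.prime.ne_zero (norm_nonneg _) ?_
  have h1 : (p : ℝ) * ‖u (i + 1)‖ ^ p ≤ p * ‖u 1‖ ^ p := by
    rw [hu i]; exact (hle i).trans (by simpa [u] using (hu 0).ge)
  exact le_of_mul_le_mul_left h1 hp

end FixedPointAndRadii

section PowerSeries

variable {K : Type*} [NontriviallyNormedField K] [CompleteSpace K] [IsUltrametricDist K]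

lemma smallPert_Qser {p : ℕ} (hp : p.Prime) (hpnorm : ‖(p : K)‖ = (p : ℝ)⁻¹) {rhat : ℝ}
    (hrhat : 1 < rhat) {a : ℕ → K} {C : ℝ} (hC : C < (p : ℝ) ^ (-(1 : ℝ) / ((p : ℝ) - 1)))
    (ha : ∀ i : ℕ, ‖a i‖ * rhat ^ i ≤ C) :
    SmallPert p (Qser a) C ((p : ℝ) ^ (-(1 : ℝ) / ((p : ℝ) - 1))) := by
  have hp1 : (1 : ℝ) < p := by exact_mod_cast hp.one_lt
  have hp2 : (2 : ℝ) ≤ p := by exact_mod_cast hp.two_le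
  have hp0 : (0 : ℝ) < p := one_pos.trans hp1
  have hr0 : 0 < rhat := one_pos.trans hrhat
  have hrinv : rhat⁻¹ < 1 := inv_lt_one_of_one_lt₀ hrhat
  have hrinv0 : 0 ≤ rhat⁻¹ := (inv_pos.2 hr0).le
  have hC0 : 0 ≤ C := le_trans (by positivity) (ha 0)
  have hgeo : ∀ i, ‖a i‖ ≤ C * rhat⁻¹ ^ i := fun i => by
    rw [inv_pow, ← div_eq_mul_inv, le_div_iff₀ (by positivity)]; exact ha i
  have haC : ∀ i, ‖a i‖ ≤ C := fun i =>
    (hgeo i).trans (mul_le_of_le_one_right hC0 (pow_le_one₀ hrinv0 hrinv.le))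
  have hterm : ∀ z : K, ‖z‖ ≤ 1 → ∀ i, ‖a i * z ^ i‖ ≤ ‖a i‖ := fun z hz i => by
    rw [norm_mul, norm_pow]
    exact mul_le_of_le_one_right (norm_nonneg _) (pow_le_one₀ (norm_nonneg _) hz)
  have hsum : ∀ z : K, ‖z‖ ≤ 1 → Summable fun i => a i * z ^ i := fun z hz =>
    Summable.of_norm_bounded ((summable_geometric_of_lt_one hrinv0 hrinv).mul_left C)
      fun i => (hterm z hz i).trans (hgeo i)
  have hsub : (p : ℝ) - 1 ≠ 0 := by linarith
  have hpow : ((p : ℝ) ^ (-(1 : ℝ) / ((p : ℝ) - 1))) ^ (p - 1) = (p : ℝ)⁻¹ := by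
    rw [← Real.rpow_natCast, ← Real.rpow_mul hp0.le, Nat.cast_sub hp.one_le, Nat.cast_one,
      div_mul_cancel₀ _ hsub, Real.rpow_neg_one]
  refine ⟨hp, hpnorm, hC0, hC, Real.rpow_lt_one_of_one_lt_of_neg hp1 ?_, ?_, ?_, ?_, ?_, ?_⟩
  · exact div_neg_of_neg_of_pos (by norm_num) (by linarith)
  · rw [← mul_pow_sub_one hp.ne_zero, hpow, mul_comm, mul_assoc, inv_mul_cancel₀ hp0.ne', mul_one]
  · rw [← Real.rpow_neg_one]
    refine Real.rpow_le_rpow_of_exponent_le hp1.le ?_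
    rw [le_div_iff₀ (by linarith)]
    linarith
  · exact fun z hz => IsUltrametricDist.norm_tsum_le_of_forall_le_of_nonneg hC0
      fun i => (hterm z hz i).trans (haC i)
  · intro z w hz hw
    rw [Qser, Qser, ← (hsum z hz).tsum_sub (hsum w hw)]
    refine IsUltrametricDist.norm_tsum_le_of_forall_le_of_nonneg (by positivity) fun i => ?_
    rw [← mul_sub, norm_mul]
    have h1 := norm_pow_sub_pow_le hz hw i
    rw [one_pow, one_mul] at h1
    exact mul_le_mul (haC i) h1 (norm_nonneg _) hC0
  · intro δ hδ
    obtain ⟨n, hn⟩ := exists_pow_lt_of_lt_one (show 0 < δ / (C + 1) by positivity) hrinv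
    rw [lt_div_iff₀ (by positivity)] at hn
    refine ⟨∑ i ∈ Finset.range n, Polynomial.C (a i) * Polynomial.X ^ i, fun z hz => ?_⟩
    have heval : (∑ i ∈ Finset.range n, Polynomial.C (a i) * Polynomial.X ^ i).eval z
        = ∑ i ∈ Finset.range n, a i * z ^ i := by
      simp [Polynomial.eval_finsetSum]
    rw [heval, Qser, ← (hsum z hz).sum_add_tsum_nat_add n, add_sub_cancel_left]
    refine IsUltrametricDist.norm_tsum_le_of_forall_le_of_nonneg hδ.le fun i => ?_
    refine (hterm z hz _).trans ((hgeo _).trans ?_)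
    have h1 : rhat⁻¹ ^ (i + n) ≤ rhat⁻¹ ^ n := pow_le_pow_of_le_one hrinv0 hrinv.le (by omega)
    have h2 : 0 ≤ rhat⁻¹ ^ n := by positivity
    calc C * rhat⁻¹ ^ (i + n) ≤ C * rhat⁻¹ ^ n := by gcongr
      _ ≤ rhat⁻¹ ^ n * (C + 1) := by linarith
      _ ≤ δ := hn.le

end PowerSeries

section Itineraries

variable {K : Type*} [NontriviallyNormedField K] {p : ℕ} {Q : K → K} {C ρ : ℝ} {R : ℕ → ℝ}

namespace EscapeRadii

lemma le_one (hR : EscapeRadii K p ρ R) (i : ℕ) : R i ≤ 1 := by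
  cases i with
  | zero => exact hR.zero.le
  | succ i => exact (hR.le_one_radius i).trans hR.one_lt_one.le

lemma succ_lt_one (hR : EscapeRadii K p ρ R) (i : ℕ) : R (i + 1) < 1 :=
  (hR.le_one_radius i).trans_lt hR.one_lt_one

variable [IsUltrametricDist K]

lemma norm_iterate_eq (hR : EscapeRadii K p ρ R) (h : SmallPert p Q C ρ) {lam y : K} {k : ℕ}
    (hl : ‖lam - 1‖ < 1) (hy : ‖y‖ = R k) {j i : ℕ} (hj : j + i = k) :
    ‖(pertMap p Q lam)^[j] y‖ = R i := by
  induction j generalizing i with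
  | zero => simp only [Function.iterate_zero, id_eq, hy]; congr 1; omega
  | succ j ih =>
    have h1 := ih (i := i + 1) (by omega)
    rw [Function.iterate_succ_apply', h.norm_map hl (by rw [h1]; exact hR.rho_lt _)
      (by rw [h1]; exact hR.succ_lt_one i), h1, hR.succ]

lemma norm_iterate_lt (hR : EscapeRadii K p ρ R) (h : SmallPert p Q C ρ) {lam y : K} {k : ℕ}
    (hl : ‖lam - 1‖ < 1) (hy : ‖y‖ < R k) {j i : ℕ} (hj : j + i = k) :
    ‖(pertMap p Q lam)^[j] y‖ < R i := by
  induction j generalizing i with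
  | zero => simpa [show i = k by omega] using hy
  | succ j ih =>
    have h1 := ih (i := i + 1) (by omega)
    rw [Function.iterate_succ_apply', ← hR.succ i]
    exact h.norm_map_lt hl (hR.rho_lt _) (hR.le_one _) h1

lemma norm_iterate_le (hR : EscapeRadii K p ρ R) (h : SmallPert p Q C ρ) {lam y : K} {k : ℕ}
    (hl : ‖lam - 1‖ < 1) (hy : ‖y‖ ≤ R k) {j i : ℕ} (hj : j + i = k) :
    ‖(pertMap p Q lam)^[j] y‖ ≤ R i := by
  rcases hy.lt_or_eq with hy | hy
  · exact (hR.norm_iterate_lt h hl hy hj).le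
  · exact (hR.norm_iterate_eq h hl hy hj).le

/-- How far apart the orbits for two parameters drift before reaching the unit circle. -/
lemma norm_iterate_sub_iterate_le (hR : EscapeRadii K p ρ R) (h : SmallPert p Q C ρ)
    {lam mu y w : K} {k : ℕ} (hl : ‖lam - 1‖ < 1) (hm : ‖mu - 1‖ < 1)
    (hy : ‖y‖ = R (k + 1)) (hw : ‖w‖ = R (k + 1)) (hyw : ‖y - w‖ ≤ (p : ℝ)⁻¹ ^ 2)
    (hlm : ‖lam - mu‖ ≤ (p : ℝ)⁻¹ ^ 2) {j i : ℕ} (hj : j + i = k) :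
    ‖(pertMap p Q lam)^[j] y - (pertMap p Q mu)^[j] w‖
      ≤ max (R 1 * ‖lam - mu‖) (R 1 ^ j * ‖y - w‖) := by
  have hR0 : 0 < R 1 := h.rho_pos.trans (hR.rho_lt 1)
  have hR1 : R 1 ≤ 1 := hR.le_one 1
  induction j generalizing i with
  | zero => simp
  | succ j ih =>
    have h0 := ih (i := i + 1) (by omega)
    have hy' := hR.norm_iterate_eq h hl hy (j := j) (i := i + 2) (by omega)
    have hw' := hR.norm_iterate_eq h hm hw (j := j) (i := i + 2) (by omega)
    set y' := (pertMap p Q lam)^[j] y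
    set w' := (pertMap p Q mu)^[j] w
    have hsmall : ‖y' - w'‖ ≤ (p : ℝ)⁻¹ ^ 2 :=
      h0.trans (max_le ((mul_le_of_le_one_left (norm_nonneg _) hR1).trans hlm)
        ((mul_le_of_le_one_left (norm_nonneg _) (pow_le_one₀ hR0.le hR1)).trans hyw))
    rw [Function.iterate_succ_apply', Function.iterate_succ_apply']
    refine norm_sub_le_of_sub_le_of_sub_le (y := pertMap p Q lam w') ?_ ?_
    · refine (h.norm_map_sub_le_of_rho_lt hl (hR.rho_lt (i + 2)) (hR.succ_lt_one _) hy'.le hw'.le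
        hsmall).trans ?_
      rw [hR.succ]
      calc R (i + 1) * ‖y' - w'‖
          ≤ R 1 * max (R 1 * ‖lam - mu‖) (R 1 ^ j * ‖y - w‖) :=
            mul_le_mul (hR.le_one_radius i) h0 (norm_nonneg _) hR0.le
        _ = max (R 1 * (R 1 * ‖lam - mu‖)) (R 1 * (R 1 ^ j * ‖y - w‖)) :=
            mul_max_of_nonneg _ _ hR0.le
        _ ≤ _ := max_le_max (by
              refine mul_le_mul_of_nonneg_left ?_ hR0.le
              exact mul_le_of_le_one_left (norm_nonneg _) hR1) (by rw [pow_succ']; ring_nf; rfl)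
    · refine le_max_of_le_left ?_
      rw [h.norm_map_sub_map, hw', hR.succ, mul_comm (R 1)]
      have h1 : ‖1 - w'‖ ≤ 1 := norm_sub_le_of_le_of_le (by simp) (hw'.le.trans (hR.le_one _))
      gcongr
      calc R (i + 1) * ‖1 - w'‖ ≤ R 1 * 1 :=
            mul_le_mul (hR.le_one_radius i) h1 (norm_nonneg _) hR0.le
        _ = R 1 := mul_one _

/-- The parameter derivative dominates at the moment the orbit reaches the unit circle. -/
lemma norm_iterate_sub_iterate_eq (hR : EscapeRadii K p ρ R) (h : SmallPert p Q C ρ)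
    {lam mu y w : K} {k : ℕ} (hl : ‖lam - 1‖ < 1) (hm : ‖mu - 1‖ < 1)
    (hy : ‖y‖ = R (k + 1)) (hw : ‖w‖ = R (k + 1)) (hyw : ‖y - w‖ ≤ (p : ℝ)⁻¹ ^ 2)
    (hlm : ‖lam - mu‖ ≤ (p : ℝ)⁻¹ ^ 2) (hlt : R 1 ^ k * ‖y - w‖ < ‖lam - mu‖) :
    ‖(pertMap p Q lam)^[k + 1] y - (pertMap p Q mu)^[k + 1] w‖ = ‖lam - mu‖ := by
  have hR0 : 0 < R 1 := h.rho_pos.trans (hR.rho_lt 1)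
  have h0 := hR.norm_iterate_sub_iterate_le h hl hm hy hw hyw hlm (j := k) (i := 0) rfl
  have he : 0 < ‖lam - mu‖ := lt_of_le_of_lt (by positivity) hlt
  have h1 := h0.trans_lt (max_lt (mul_lt_of_lt_one_left he hR.one_lt_one) hlt)
  have hy' := hR.norm_iterate_eq h hl hy (j := k) (i := 1) rfl
  have hw' := hR.norm_iterate_eq h hm hw (j := k) (i := 1) rfl
  rw [Function.iterate_succ_apply', Function.iterate_succ_apply']
  set y' := (pertMap p Q lam)^[k] y
  set w' := (pertMap p Q mu)^[k] w
  have hnorm : ‖1 - w'‖ = 1 := by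
    rw [← norm_one (α := K)]
    refine norm_eq_of_norm_sub_lt (x := 1 - w') ?_
    rw [sub_sub_cancel_left, norm_neg, hw', norm_one]
    exact hR.one_lt_one
  have hpar : ‖pertMap p Q lam w' - pertMap p Q mu w'‖ = ‖lam - mu‖ := by
    have h2 := hR.succ 0
    rw [zero_add, hR.zero] at h2
    rw [h.norm_map_sub_map, hw', h2, hnorm, one_mul, mul_one]
  rw [← sub_add_sub_cancel _ (pertMap p Q lam w'), norm_add_eq_right_of_lt, hpar]
  rw [hpar]
  refine lt_of_le_of_lt (h.norm_map_sub_le_of_rho_lt hl (hR.rho_lt 1) hR.one_lt_one hy'.le hw'.le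
    (h1.le.trans hlm)) ?_
  rwa [hR.succ 0, hR.zero, one_mul]

/-- The contraction of phase discs until the unit circle is reached. -/
lemma norm_iterate_succ_sub_le (hR : EscapeRadii K p ρ R) (h : SmallPert p Q C ρ)
    {lam y w : K} {k : ℕ} (hl : ‖lam - 1‖ < 1) (hy : ‖y‖ = R (k + 1)) (hw : ‖w‖ = R (k + 1))
    (hyw : ‖y - w‖ ≤ (p : ℝ)⁻¹ ^ 2) :
    (∀ j ≤ k, ‖(pertMap p Q lam)^[j] y - (pertMap p Q lam)^[j] w‖ ≤ R 1 ^ j * ‖y - w‖) ∧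
      ‖(pertMap p Q lam)^[k + 1] y - (pertMap p Q lam)^[k + 1] w‖ ≤ R 1 ^ k * ‖y - w‖ := by
  have hR0 : 0 < R 1 := h.rho_pos.trans (hR.rho_lt 1)
  have h0 : ∀ j ≤ k, ‖(pertMap p Q lam)^[j] y - (pertMap p Q lam)^[j] w‖ ≤ R 1 ^ j * ‖y - w‖ := by
    intro j hj
    refine (hR.norm_iterate_sub_iterate_le h hl hl hy hw hyw (by simp) (j := j) (i := k - j)
      (by omega)).trans (max_le ?_ le_rfl)
    simp only [sub_self, norm_zero, mul_zero]
    positivity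
  refine ⟨h0, ?_⟩
  have hsmall := (h0 k le_rfl).trans ((mul_le_of_le_one_left (norm_nonneg _)
    (pow_le_one₀ hR0.le (hR.le_one 1))).trans hyw)
  rw [Function.iterate_succ_apply', Function.iterate_succ_apply']
  refine (h.norm_map_sub_le_of_rho_lt hl (hR.rho_lt 1) hR.one_lt_one
    (hR.norm_iterate_eq h hl hy (j := k) (i := 1) rfl).le
    (hR.norm_iterate_eq h hl hw (j := k) (i := 1) rfl).le hsmall).trans ?_
  rw [hR.succ 0, hR.zero, one_mul]
  exact h0 k le_rfl

end EscapeRadii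

namespace SmallPert

variable [IsUltrametricDist K]

lemma norm_iterate_sub_fixedPoint_le (h : SmallPert p Q C ρ) {lam b y : K} {M : ℕ}
    (hl : ‖lam - 1‖ < 1) (hb : ‖b - 1‖ ≤ (p : ℝ)⁻¹) (hfix : pertMap p Q lam b = b)
    (hy : ‖y - b‖ ≤ (p : ℝ)⁻¹ ^ M) {j i : ℕ} (hj : j + i = M) :
    ‖(pertMap p Q lam)^[j] y - b‖ ≤ (p : ℝ)⁻¹ ^ i := by
  have hp := h.p_pos
  have hi := h.inv_pos
  induction j generalizing i with
  | zero => simpa [show i = M by omega] using hy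
  | succ j ih =>
    have h0 := ih (i := i + 1) (by omega)
    have h1 : (p : ℝ)⁻¹ ^ (i + 1) ≤ (p : ℝ)⁻¹ :=
      pow_le_of_le_one hi.le h.inv_lt_one.le (by omega)
    rw [Function.iterate_succ_apply']
    nth_rw 1 [← hfix]
    rw [h.norm_map_sub_eq hl (norm_sub_le_of_sub_le_of_sub_le (h0.trans h1) hb) hb]
    calc (p : ℝ) * ‖(pertMap p Q lam)^[j] y - b‖ ≤ p * (p : ℝ)⁻¹ ^ (i + 1) := by gcongr
      _ = (p : ℝ)⁻¹ ^ i := by rw [pow_succ']; exact mul_inv_cancel_left₀ hp.ne' _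

lemma norm_iterate_sub_iterate_eq (h : SmallPert p Q C ρ) {lam mu y w : K} {M : ℕ}
    (hl : ‖lam - 1‖ < 1)
    (hy : ∀ j < M, ‖(pertMap p Q lam)^[j] y - 1‖ ≤ (p : ℝ)⁻¹)
    (hw : ∀ j < M, ‖(pertMap p Q mu)^[j] w - 1‖ ≤ (p : ℝ)⁻¹)
    (hyw : ‖y - w‖ = ‖lam - mu‖) {j : ℕ} (hj : j ≤ M) :
    ‖(pertMap p Q lam)^[j] y - (pertMap p Q mu)^[j] w‖ = p ^ j * ‖lam - mu‖ := by
  have hp := h.p_pos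
  rcases eq_or_ne lam mu with rfl | hne
  · have : y = w := by simpa [sub_eq_zero] using hyw
    simp [this]
  have he : 0 < ‖lam - mu‖ := norm_pos_iff.2 (sub_ne_zero.2 hne)
  induction j with
  | zero => simpa using hyw
  | succ j ih =>
    have h0 := ih (by omega)
    have hy' := hy j (by omega)
    have hw' := hw j (by omega)
    rw [Function.iterate_succ_apply', Function.iterate_succ_apply']
    set y' := (pertMap p Q lam)^[j] y
    set w' := (pertMap p Q mu)^[j] w
    have h1 : ‖pertMap p Q lam y' - pertMap p Q lam w'‖ = p ^ (j + 1) * ‖lam - mu‖ := by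
      rw [h.norm_map_sub_eq hl hy' hw', h0, pow_succ']; ring
    have h2 : ‖pertMap p Q lam w' - pertMap p Q mu w'‖ ≤ ‖lam - mu‖ := by
      rw [h.norm_map_sub_map, h.norm_eq_one_of_sub_one hw', one_pow, mul_one, norm_sub_rev 1 w']
      refine mul_le_of_le_one_right he.le ?_
      calc (p : ℝ) * ‖w' - 1‖ ≤ p * (p : ℝ)⁻¹ := by gcongr
        _ = 1 := mul_inv_cancel₀ hp.ne'
    rw [← sub_add_sub_cancel _ (pertMap p Q lam w'), norm_add_eq_left_of_lt, h1]
    rw [h1]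
    exact h2.trans_lt (lt_mul_of_one_lt_left he (one_lt_pow₀ h.one_lt_p (by omega)))

lemma norm_iterate_sub_iterate_le (h : SmallPert p Q C ρ) {lam y w : K} {M : ℕ}
    (hl : ‖lam - 1‖ < 1) (hw : ∀ j ≤ M, ‖(pertMap p Q lam)^[j] w‖ ≤ 1)
    (hyw : p ^ M * ‖y - w‖ ≤ 1) {j : ℕ} (hj : j ≤ M) :
    ‖(pertMap p Q lam)^[j] y - (pertMap p Q lam)^[j] w‖ ≤ p ^ j * ‖y - w‖ := by
  have hp := h.p_pos
  induction j with
  | zero => simp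
  | succ j ih =>
    have h0 := ih (by omega)
    have hw' := hw j (by omega)
    rw [Function.iterate_succ_apply', Function.iterate_succ_apply']
    set y' := (pertMap p Q lam)^[j] y
    set w' := (pertMap p Q lam)^[j] w
    have h1 : ‖y' - w'‖ ≤ 1 := h0.trans (le_trans (by
      have := h.one_lt_p.le
      gcongr
      omega) hyw)
    have hy' : ‖y'‖ ≤ 1 := by
      rw [← sub_add_cancel y' w']; exact norm_add_le_of_le_of_le h1 hw'
    refine (h.norm_map_sub_le hl hy' hw').trans ?_
    rw [pow_succ', mul_assoc]
    gcongr

end SmallPert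

end Itineraries

section Stages

variable {K : Type*} [NontriviallyNormedField K] {p : ℕ} {Q : K → K} {C ρ θ r : ℝ} {R : ℕ → ℝ}
  {β : K → K} {x c lam mu z : K} {n M : ℕ}

/-- `β` selects a fixed point close to `1` for each parameter with `‖lam - 1‖ ≤ θ`. -/
structure FixedPoints (p : ℕ) (Q : K → K) (θ : ℝ) (β : K → K) : Prop where
  inv_le : (p : ℝ)⁻¹ ≤ θ
  lt_one : θ < 1
  near_one : ∀ lam, ‖lam - 1‖ ≤ θ → ‖β lam - 1‖ ≤ (p : ℝ)⁻¹
  fixed : ∀ lam, ‖lam - 1‖ ≤ θ → pertMap p Q lam (β lam) = β lam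

/-- A stage of the construction: for all parameters in the ball of radius `p⁻ᴹ` about `c`, the
`n`-th iterate of the disc `closedBall x r` is within `p⁻ᴹ` of the repelling fixed point, and the
orbit of `x` up to that time stays in the unit ball and depends isometrically on the parameter at
time `n`. -/
structure Stage (p : ℕ) (Q : K → K) (θ : ℝ) (β : K → K) (x : K) (r : ℝ) (n M : ℕ) (c : K) :
    Prop where
  one_le : 1 ≤ M
  center : ‖c - 1‖ ≤ θ
  near : ‖(pertMap p Q c)^[n] x - β c‖ ≤ (p : ℝ)⁻¹ ^ M
  scale : ∀ lam mu, ‖lam - c‖ ≤ (p : ℝ)⁻¹ ^ M → ‖mu - c‖ ≤ (p : ℝ)⁻¹ ^ M →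
    ‖(pertMap p Q lam)^[n] x - (pertMap p Q mu)^[n] x‖ = ‖lam - mu‖
  le_one : ∀ lam, ‖lam - c‖ ≤ (p : ℝ)⁻¹ ^ M → ∀ j ≤ n, ‖(pertMap p Q lam)^[j] x‖ ≤ 1
  disc : ∀ lam, ‖lam - c‖ ≤ (p : ℝ)⁻¹ ^ M → ∀ z, ‖z - x‖ ≤ r → ∀ j ≤ n,
    ‖(pertMap p Q lam)^[j] z - (pertMap p Q lam)^[j] x‖ < ‖(pertMap p Q lam)^[j] x‖
  disc_end : ∀ lam, ‖lam - c‖ ≤ (p : ℝ)⁻¹ ^ M → ∀ z, ‖z - x‖ ≤ r →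
    ‖(pertMap p Q lam)^[n] z - (pertMap p Q lam)^[n] x‖ ≤ (p : ℝ)⁻¹ ^ (M + 2)

namespace Stage

variable [IsUltrametricDist K]

lemma norm_sub_one_le (hs : Stage p Q θ β x r n M c) (h : SmallPert p Q C ρ)
    (hβ : FixedPoints p Q θ β) (hl : ‖lam - c‖ ≤ (p : ℝ)⁻¹ ^ M) : ‖lam - 1‖ ≤ θ := by
  have h1 := pow_le_of_le_one h.inv_pos.le h.inv_lt_one.le (show M ≠ 0 by have := hs.one_le; omega)
  exact norm_sub_le_of_sub_le_of_sub_le (hl.trans (h1.trans hβ.inv_le)) hs.center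

lemma norm_iterate_sub_fixedPoint_le (hs : Stage p Q θ β x r n M c) (h : SmallPert p Q C ρ)
    (hβ : FixedPoints p Q θ β) (hl : ‖lam - c‖ ≤ (p : ℝ)⁻¹ ^ M) {j i : ℕ} (hj : j + i = M) :
    ‖(pertMap p Q lam)^[j + n] x - β lam‖ ≤ (p : ℝ)⁻¹ ^ i := by
  have hl1 := hs.norm_sub_one_le h hβ hl
  have hl1' := hl1.trans_lt hβ.lt_one
  have hc0 : ‖c - c‖ ≤ (p : ℝ)⁻¹ ^ M := by
    rw [sub_self, norm_zero]; exact pow_nonneg h.inv_pos.le M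
  rw [Function.iterate_add_apply]
  refine h.norm_iterate_sub_fixedPoint_le hl1' (hβ.near_one _ hl1) (hβ.fixed _ hl1) ?_ hj
  refine norm_sub_le_of_sub_le_of_sub_le (y := (pertMap p Q c)^[n] x)
    ((hs.scale lam c hl hc0).trans_le hl) (norm_sub_le_of_sub_le_of_sub_le hs.near ?_)
  refine (h.norm_fixedPoint_sub_le (hs.center.trans_lt hβ.lt_one) (hβ.near_one _ hs.center)
    (hβ.near_one _ hl1) (hβ.fixed _ hs.center) (hβ.fixed _ hl1)).trans ?_
  rwa [norm_sub_rev]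

lemma norm_iterate_sub_one_le (hs : Stage p Q θ β x r n M c) (h : SmallPert p Q C ρ)
    (hβ : FixedPoints p Q θ β) (hl : ‖lam - c‖ ≤ (p : ℝ)⁻¹ ^ M) {j : ℕ} (hj : j < M) :
    ‖(pertMap p Q lam)^[j + n] x - 1‖ ≤ (p : ℝ)⁻¹ :=
  norm_sub_le_of_sub_le_of_sub_le
    ((hs.norm_iterate_sub_fixedPoint_le h hβ hl (j := j) (i := M - j) (by omega)).trans
      (pow_le_of_le_one h.inv_pos.le h.inv_lt_one.le (by omega)))
    (hβ.near_one _ (hs.norm_sub_one_le h hβ hl))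

lemma norm_iterate_add_le_one (hs : Stage p Q θ β x r n M c) (h : SmallPert p Q C ρ)
    (hβ : FixedPoints p Q θ β) (hl : ‖lam - c‖ ≤ (p : ℝ)⁻¹ ^ M) {j : ℕ} (hj : j ≤ M) :
    ‖(pertMap p Q lam)^[j + n] x‖ ≤ 1 := by
  rw [← sub_add_cancel ((pertMap p Q lam)^[j + n] x) (β lam)]
  refine norm_add_le_of_le_of_le
    ((hs.norm_iterate_sub_fixedPoint_le h hβ hl (j := j) (i := M - j) (by omega)).trans
      (pow_le_one₀ h.inv_pos.le h.inv_lt_one.le))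
    (h.norm_eq_one_of_sub_one (hβ.near_one _ (hs.norm_sub_one_le h hβ hl))).le

lemma norm_iterate_le_one (hs : Stage p Q θ β x r n M c) (h : SmallPert p Q C ρ)
    (hβ : FixedPoints p Q θ β) (hl : ‖lam - c‖ ≤ (p : ℝ)⁻¹ ^ M) {j : ℕ} (hj : j ≤ M + n) :
    ‖(pertMap p Q lam)^[j] x‖ ≤ 1 := by
  rcases le_total j n with hjn | hjn
  · exact hs.le_one lam hl j hjn
  · obtain ⟨i, rfl⟩ := Nat.exists_eq_add_of_le' hjn
    exact hs.norm_iterate_add_le_one h hβ hl (by omega)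

lemma norm_param_sub (hs : Stage p Q θ β x r n M c) (h : SmallPert p Q C ρ)
    (hβ : FixedPoints p Q θ β) (hl : ‖lam - c‖ ≤ (p : ℝ)⁻¹ ^ M) (hm : ‖mu - c‖ ≤ (p : ℝ)⁻¹ ^ M) :
    ‖(pertMap p Q lam)^[M + n] x - (pertMap p Q mu)^[M + n] x‖ = p ^ M * ‖lam - mu‖ := by
  rw [Function.iterate_add_apply, Function.iterate_add_apply]
  refine h.norm_iterate_sub_iterate_eq ((hs.norm_sub_one_le h hβ hl).trans_lt hβ.lt_one)
    (fun j hj => ?_) (fun j hj => ?_) (hs.scale lam mu hl hm) le_rfl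
  · rw [← Function.iterate_add_apply]; exact hs.norm_iterate_sub_one_le h hβ hl hj
  · rw [← Function.iterate_add_apply]; exact hs.norm_iterate_sub_one_le h hβ hm hj

lemma disc_add (hs : Stage p Q θ β x r n M c) (h : SmallPert p Q C ρ)
    (hβ : FixedPoints p Q θ β) (hl : ‖lam - c‖ ≤ (p : ℝ)⁻¹ ^ M) (hz : ‖z - x‖ ≤ r) {j : ℕ}
    (hj : j ≤ M) :
    ‖(pertMap p Q lam)^[j + n] z - (pertMap p Q lam)^[j + n] x‖ ≤ (p : ℝ)⁻¹ ^ 2 := by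
  have hp := h.p_pos
  have hpM : (p : ℝ) ^ M * (p : ℝ)⁻¹ ^ (M + 2) = (p : ℝ)⁻¹ ^ 2 := by
    rw [pow_add, ← mul_assoc, ← mul_pow, mul_inv_cancel₀ hp.ne', one_pow, one_mul]
  have hend := hs.disc_end lam hl z hz
  have hM : (p : ℝ) ^ M * ‖(pertMap p Q lam)^[n] z - (pertMap p Q lam)^[n] x‖ ≤ (p : ℝ)⁻¹ ^ 2 := by
    rw [← hpM]; gcongr
  rw [Function.iterate_add_apply, Function.iterate_add_apply]
  refine (h.norm_iterate_sub_iterate_le ((hs.norm_sub_one_le h hβ hl).trans_lt hβ.lt_one)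
    (fun i hi => ?_) (hM.trans (pow_le_one₀ h.inv_pos.le h.inv_lt_one.le)) hj).trans
    (le_trans ?_ hM)
  · rw [← Function.iterate_add_apply]; exact hs.norm_iterate_add_le_one h hβ hl hi
  · have := h.one_lt_p.le
    gcongr

/-- Perturbing the parameter makes the orbit leave the fixed point, fall into the open unit disc
and come back closer to the fixed point. -/
lemma exists_next [IsAlgClosed K] (hs : Stage p Q θ β x r n M c) (h : SmallPert p Q C ρ)
    (hβ : FixedPoints p Q θ β) (hR : EscapeRadii K p ρ R) :
    ∃ n' c', Stage p Q θ β x r n' (M + 2) c' ∧ n + M < n' ∧ ‖c' - c‖ ≤ (p : ℝ)⁻¹ ^ M ∧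
      ∀ lam, ‖lam - c'‖ ≤ (p : ℝ)⁻¹ ^ (M + 2) → ‖(pertMap p Q lam)^[M + n] x‖ < 1 := by
  have hp := h.p_pos
  have hi0 := h.inv_pos
  have hi1 := h.inv_lt_one
  have hθ0 : 0 ≤ θ := hi0.le.trans hβ.inv_le
  have hR0 : 0 < R 1 := h.rho_pos.trans (hR.rho_lt 1)
  have hpow : 0 < (p : ℝ)⁻¹ ^ (M + 2) := pow_pos hi0 _
  have hpM : 0 < (p : ℝ)⁻¹ ^ M := pow_pos hi0 _
  have hcancel : (p : ℝ) ^ M * (p : ℝ)⁻¹ ^ M = 1 := by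
    rw [← mul_pow, mul_inv_cancel₀ hp.ne', one_pow]
  have hsq : (p : ℝ)⁻¹ ^ 2 < ρ :=
    (pow_lt_self_of_lt_one₀ hi0 hi1 one_lt_two).trans_le h.inv_le_rho
  have hball : ∀ {s : ℝ} {lam c : K}, lam ∈ closedBall c s ↔ ‖lam - c‖ ≤ s := by
    intro s lam c; rw [mem_closedBall, dist_eq_norm]
  have hl1 : ∀ lam, ‖lam - c‖ ≤ (p : ℝ)⁻¹ ^ M → ‖lam - 1‖ < 1 := fun lam hl =>
    (hs.norm_sub_one_le h hβ hl).trans_lt hβ.lt_one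
  have hc0 : ‖c - c‖ ≤ (p : ℝ)⁻¹ ^ M := by rw [sub_self, norm_zero]; exact hpM.le
  obtain ⟨c₁, hc₁, hsmall⟩ : ∃ c₁, ‖c₁ - c‖ ≤ (p : ℝ)⁻¹ ^ M ∧
      ‖(pertMap p Q c₁)^[M + n] x‖ < ρ := by
    have hpoly : PolyApprox (closedBall c ((p : ℝ)⁻¹ ^ M))
        fun lam => (pertMap p Q lam)^[M + n] x :=
      h.polyApprox_iterate (fun lam hl => hl1 lam (hball.1 hl))
        fun lam hl j hj => hs.norm_iterate_le_one h hβ (hball.1 hl) hj.le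
    have hz : ‖c + (p : K) ^ M - c‖ = (p : ℝ)⁻¹ ^ M := by
      rw [add_sub_cancel_left, norm_pow, h.norm_p]
    obtain ⟨c₁, hc₁, h₁⟩ := hpoly.exists_norm_sub_lt (hball.2 hz.le) 0 (by
      rw [hs.norm_param_sub h hβ hz.le hc0, hz, hcancel, sub_zero]
      exact hs.norm_iterate_le_one h hβ hc0 le_rfl) h.rho_pos
    exact ⟨c₁, hball.1 hc₁, by simpa using h₁⟩
  obtain ⟨k, hk⟩ := exists_pow_lt_of_lt_one hpow hR.one_lt_one
  obtain ⟨v, hv⟩ := hR.attained (k + 1)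
  obtain ⟨m, hm⟩ := exists_pow_lt_of_lt_one hpow hβ.lt_one
  have hrad : ∀ lam, ‖lam - c₁‖ ≤ (p : ℝ)⁻¹ ^ M * R (k + 1) → ‖lam - c‖ ≤ (p : ℝ)⁻¹ ^ M :=
    fun lam hl => norm_sub_le_of_sub_le_of_sub_le
      (hl.trans (mul_le_of_le_one_right hpM.le (hR.le_one _))) hc₁
  have hY : ∀ lam, ‖lam - c₁‖ ≤ (p : ℝ)⁻¹ ^ M * R (k + 1) →
      ‖(pertMap p Q lam)^[M + n] x‖ ≤ R (k + 1) := fun lam hl => by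
    rw [← sub_add_cancel ((pertMap p Q lam)^[M + n] x) ((pertMap p Q c₁)^[M + n] x)]
    refine norm_add_le_of_le_of_le ?_ (hsmall.trans (hR.rho_lt _)).le
    rw [hs.norm_param_sub h hβ (hrad _ hl) hc₁]
    calc (p : ℝ) ^ M * ‖lam - c₁‖ ≤ p ^ M * ((p : ℝ)⁻¹ ^ M * R (k + 1)) := by gcongr
      _ = R (k + 1) := by rw [← mul_assoc, hcancel, one_mul]
  obtain ⟨c', hc'₁, hc'⟩ : ∃ c', ‖c' - c₁‖ ≤ (p : ℝ)⁻¹ ^ M * R (k + 1) ∧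
      ‖(pertMap p Q c')^[k + 1 + (M + n)] x - (fixStep p Q c')^[m] 1‖ < (p : ℝ)⁻¹ ^ (M + 2) := by
    have hpoly : PolyApprox (closedBall c₁ ((p : ℝ)⁻¹ ^ M * R (k + 1)))
        fun lam => (pertMap p Q lam)^[k + 1 + (M + n)] x - (fixStep p Q lam)^[m] 1 := by
      refine (h.polyApprox_iterate (fun lam hl => hl1 lam (hrad _ (hball.1 hl)))
        fun lam hl j hj => ?_).sub (h.polyApprox_fixStep_iterate hβ.inv_le hβ.lt_one
          (fun lam hl => hs.norm_sub_one_le h hβ (hrad _ (hball.1 hl))) m)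
      rcases le_total j (M + n) with hjn | hjn
      · exact hs.norm_iterate_le_one h hβ (hrad _ (hball.1 hl)) hjn
      · obtain ⟨i, rfl⟩ := Nat.exists_eq_add_of_le' hjn
        rw [Function.iterate_add_apply]
        exact (hR.norm_iterate_le h (hl1 lam (hrad _ (hball.1 hl))) (hY _ (hball.1 hl))
          (j := i) (i := k + 1 - i) (by omega)).trans (hR.le_one _)
    have hz : ‖c₁ + (p : K) ^ M * v - c₁‖ = (p : ℝ)⁻¹ ^ M * R (k + 1) := by
      rw [add_sub_cancel_left, norm_mul, norm_pow, h.norm_p, hv]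
    set z := c₁ + (p : K) ^ M * v
    have hzc := hrad _ hz.le
    have hYsub : ‖(pertMap p Q z)^[M + n] x - (pertMap p Q c₁)^[M + n] x‖ = R (k + 1) := by
      rw [hs.norm_param_sub h hβ hzc hc₁, hz, ← mul_assoc, hcancel, one_mul]
    have hYz : ‖(pertMap p Q z)^[M + n] x‖ = R (k + 1) := by
      rw [← hYsub, ← sub_add_cancel ((pertMap p Q z)^[M + n] x) ((pertMap p Q c₁)^[M + n] x),
        norm_add_eq_left_of_lt, sub_add_cancel]
      rw [hYsub]
      exact hsmall.trans (hR.rho_lt _)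
    have hFz : ‖(pertMap p Q z)^[k + 1 + (M + n)] x‖ = 1 := by
      rw [Function.iterate_add_apply, hR.norm_iterate_eq h (hl1 _ hzc) hYz (i := 0) rfl, hR.zero]
    have hFc : ‖(pertMap p Q c₁)^[k + 1 + (M + n)] x‖ < 1 := by
      rw [Function.iterate_add_apply, ← hR.zero]
      exact hR.norm_iterate_lt h (hl1 _ hc₁) (hsmall.trans (hR.rho_lt _)) (i := 0) rfl
    have hT := fun lam (hl : ‖lam - c‖ ≤ (p : ℝ)⁻¹ ^ M) =>
      h.norm_fixStep_iterate_sub_one_le hβ.inv_le hβ.lt_one (hs.norm_sub_one_le h hβ hl) m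
    have hTT : ‖(fixStep p Q c₁)^[m] 1 - (fixStep p Q z)^[m] 1‖ < 1 :=
      (norm_sub_le_of_sub_le_of_sub_le (hT _ hc₁)
        (by rw [norm_sub_rev]; exact hT _ hzc)).trans_lt hi1
    obtain ⟨c', hc', h'⟩ := hpoly.exists_norm_sub_lt (hball.2 hz.le) 0 (by
      have : ((pertMap p Q z)^[k + 1 + (M + n)] x - (fixStep p Q z)^[m] 1)
          - ((pertMap p Q c₁)^[k + 1 + (M + n)] x - (fixStep p Q c₁)^[m] 1)
          = (pertMap p Q z)^[k + 1 + (M + n)] x + (-((pertMap p Q c₁)^[k + 1 + (M + n)] x)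
            + ((fixStep p Q c₁)^[m] 1 - (fixStep p Q z)^[m] 1)) := by ring
      rw [this, norm_add_eq_left_of_lt, hFz, sub_zero]
      · exact norm_sub_le_of_le_of_le hFc.le (h.norm_eq_one_of_sub_one (hT _ hc₁)).le
      · rw [hFz]; exact norm_add_lt_of_lt_of_lt (by rwa [norm_neg]) hTT) hpow
    exact ⟨c', hball.1 hc', by simpa using h'⟩
  have hc'c := hrad _ hc'₁
  have hc'θ := hs.norm_sub_one_le h hβ hc'c
  have hnear : ‖(pertMap p Q c')^[k + 1 + (M + n)] x - β c'‖ ≤ (p : ℝ)⁻¹ ^ (M + 2) :=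
    norm_sub_le_of_sub_le_of_sub_le hc'.le ((h.norm_fixStep_iterate_sub_le hβ.inv_le hβ.lt_one
      hc'θ (hβ.near_one _ hc'θ) (hβ.fixed _ hc'θ) m).trans hm.le)
  have hβ1 := h.norm_eq_one_of_sub_one (hβ.near_one _ hc'θ)
  have hYc' : ‖(pertMap p Q c')^[M + n] x‖ = R (k + 1) := by
    refine (hY _ hc'₁).eq_of_not_lt fun hlt => ?_
    have h1 := hR.norm_iterate_lt h (hl1 _ hc'c) hlt (j := k + 1) (i := 0) rfl
    rw [← Function.iterate_add_apply, hR.zero] at h1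
    refine h1.ne ((norm_eq_of_norm_sub_lt (y := β c') ?_).trans hβ1)
    rw [hβ1]
    exact hnear.trans_lt (pow_lt_one₀ hi0.le hi1 (by omega))
  have hsub : ∀ lam, ‖lam - c'‖ ≤ (p : ℝ)⁻¹ ^ (M + 2) → ‖lam - c‖ ≤ (p : ℝ)⁻¹ ^ M := fun lam hl =>
    norm_sub_le_of_sub_le_of_sub_le
      (hl.trans (pow_le_pow_of_le_one hi0.le hi1.le (by omega))) hc'c
  have hpM2 : (p : ℝ) ^ M * (p : ℝ)⁻¹ ^ (M + 2) = (p : ℝ)⁻¹ ^ 2 := by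
    rw [pow_add, ← mul_assoc, hcancel, one_mul]
  have hY' : ∀ lam, ‖lam - c'‖ ≤ (p : ℝ)⁻¹ ^ (M + 2) →
      ‖(pertMap p Q lam)^[M + n] x‖ = R (k + 1) := fun lam hl => by
    rw [← hYc']
    refine norm_eq_of_norm_sub_lt ?_
    rw [hYc', hs.norm_param_sub h hβ (hsub _ hl) hc'c]
    refine lt_of_le_of_lt ?_ (hsq.trans (hR.rho_lt _))
    rw [← hpM2]; gcongr
  have hsq2 : (p : ℝ)⁻¹ ^ (M + 2) ≤ (p : ℝ)⁻¹ ^ 2 :=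
    pow_le_pow_of_le_one hi0.le hi1.le (by omega)
  have hYz : ∀ lam, ‖lam - c'‖ ≤ (p : ℝ)⁻¹ ^ (M + 2) → ∀ z, ‖z - x‖ ≤ r →
      ‖(pertMap p Q lam)^[M + n] z‖ = R (k + 1) := fun lam hl z hz => by
    rw [← hY' lam hl]
    refine norm_eq_of_norm_sub_lt ?_
    rw [hY' lam hl]
    exact (hs.disc_add h hβ (hsub _ hl) hz le_rfl).trans_lt (hsq.trans (hR.rho_lt _))
  refine ⟨k + 1 + (M + n), c', ⟨by omega, hc'θ, hnear, ?_, ?_, ?_, ?_⟩, by omega, hc'c,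
    fun lam hl => (hY' lam hl).trans_lt (hR.succ_lt_one k)⟩
  · intro lam mu hl hm
    rcases eq_or_ne lam mu with rfl | hne
    · simp
    have he : 0 < ‖lam - mu‖ := norm_pos_iff.2 (sub_ne_zero.2 hne)
    have hlm : ‖lam - mu‖ ≤ (p : ℝ)⁻¹ ^ (M + 2) :=
      norm_sub_le_of_sub_le_of_sub_le hl (by rwa [norm_sub_rev])
    have hd := hs.norm_param_sub h hβ (hsub _ hl) (hsub _ hm)
    rw [Function.iterate_add_apply _ (k + 1), Function.iterate_add_apply _ (k + 1)]
    refine hR.norm_iterate_sub_iterate_eq h (hl1 _ (hsub _ hl)) (hl1 _ (hsub _ hm)) (hY' _ hl)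
      (hY' _ hm) ?_ (hlm.trans hsq2) ?_
    · rw [hd, ← hpM2]; gcongr
    · rw [hd, ← mul_assoc]
      refine mul_lt_of_lt_one_left he ?_
      calc R 1 ^ k * (p : ℝ) ^ M < (p : ℝ)⁻¹ ^ (M + 2) * (p : ℝ) ^ M := by gcongr
        _ = (p : ℝ)⁻¹ ^ 2 := by rw [mul_comm, hpM2]
        _ ≤ 1 := pow_le_one₀ hi0.le hi1.le
  · intro lam hl j hj
    rcases le_total j (M + n) with hjn | hjn
    · exact hs.norm_iterate_le_one h hβ (hsub _ hl) hjn
    · obtain ⟨i, rfl⟩ := Nat.exists_eq_add_of_le' hjn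
      rw [Function.iterate_add_apply]
      exact (hR.norm_iterate_le h (hl1 _ (hsub _ hl)) (hY' _ hl).le
          (j := i) (i := k + 1 - i) (by omega)).trans (hR.le_one _)
  · intro lam hl z hz j hj
    rcases le_total j n with hjn | hjn
    · exact hs.disc lam (hsub _ hl) z hz j hjn
    obtain ⟨i, rfl⟩ := Nat.exists_eq_add_of_le' hjn
    rcases lt_or_ge i M with hi | hi
    · rw [h.norm_eq_one_of_sub_one (hs.norm_iterate_sub_one_le h hβ (hsub _ hl) hi)]
      exact (hs.disc_add h hβ (hsub _ hl) hz hi.le).trans_lt (hsq.trans h.rho_lt_one)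
    obtain ⟨i, rfl⟩ := Nat.exists_eq_add_of_le' hi
    obtain ⟨i', hi'⟩ := Nat.exists_eq_add_of_le (show i ≤ k + 1 by omega)
    have hdisc := hs.disc_add h hβ (hsub _ hl) hz le_rfl
    have hcontr := hR.norm_iterate_succ_sub_le h (hl1 _ (hsub _ hl)) (hYz _ hl z hz) (hY' _ hl)
      hdisc
    have hRpow : ∀ e, R 1 ^ e * ‖(pertMap p Q lam)^[M + n] z - (pertMap p Q lam)^[M + n] x‖ < ρ :=
      fun e => ((mul_le_of_le_one_left (norm_nonneg _) (pow_le_one₀ hR0.le (hR.le_one 1))).trans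
        hdisc).trans_lt hsq
    rw [add_assoc i M n, Function.iterate_add_apply, Function.iterate_add_apply _ i,
      hR.norm_iterate_eq h (hl1 _ (hsub _ hl)) (hY' _ hl) hi'.symm]
    refine lt_trans ?_ (hR.rho_lt i')
    rcases (show i ≤ k + 1 by omega).eq_or_lt with rfl | hik
    · exact hcontr.2.trans_lt (hRpow k)
    · exact (hcontr.1 i (by omega)).trans_lt (hRpow i)
  · intro lam hl z hz
    have hdisc := hs.disc_add h hβ (hsub _ hl) hz le_rfl
    rw [Function.iterate_add_apply, Function.iterate_add_apply _ (k + 1)]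
    refine (hR.norm_iterate_succ_sub_le h (hl1 _ (hsub _ hl)) (hYz _ hl z hz) (hY' _ hl)
      hdisc).2.trans ?_
    calc R 1 ^ k * ‖(pertMap p Q lam)^[M + n] z - (pertMap p Q lam)^[M + n] x‖
        ≤ (p : ℝ)⁻¹ ^ (M + 2) * (p : ℝ)⁻¹ ^ 2 := by gcongr
      _ = (p : ℝ)⁻¹ ^ (M + 2 + 2) := (pow_add _ _ _).symm

end Stage

/-- The first stage: a point on the circle of radius `R 1` whose image is close to the fixed
point. -/
lemma SmallPert.exists_stage [IsUltrametricDist K] [IsAlgClosed K] (h : SmallPert p Q C ρ)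
    (hβ : FixedPoints p Q θ β) (hR : EscapeRadii K p ρ R) (hl : ‖lam - 1‖ ≤ θ) (hM : 1 ≤ M) :
    ∃ x, Stage p Q θ β x ((p : ℝ)⁻¹ ^ (M + 2)) 1 M lam := by
  have hp := h.p_pos
  have hi0 := h.inv_pos
  have hi1 := h.inv_lt_one
  have hl1 := hl.trans_lt hβ.lt_one
  have hpM : 0 < (p : ℝ)⁻¹ ^ M := pow_pos hi0 _
  have hR0 : 0 < R 1 := h.rho_pos.trans (hR.rho_lt 1)
  have hsq : (p : ℝ)⁻¹ ^ 2 < R 1 :=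
    ((pow_lt_self_of_lt_one₀ hi0 hi1 one_lt_two).trans_le h.inv_le_rho).trans (hR.rho_lt 1)
  have hsq2 : (p : ℝ)⁻¹ ^ (M + 2) ≤ (p : ℝ)⁻¹ ^ 2 :=
    pow_le_pow_of_le_one hi0.le hi1.le (by omega)
  have hpR : p * R 1 ^ p = 1 := by rw [← hR.zero]; exact hR.succ 0
  have hβ1 := h.norm_eq_one_of_sub_one (hβ.near_one _ hl)
  have hball : ∀ {s : ℝ} {z : K}, z ∈ closedBall 0 s ↔ ‖z‖ ≤ s := by simp
  obtain ⟨v, hv⟩ := hR.attained 1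
  have hE0 : ‖pertMap p Q lam 0‖ < 1 := by
    have : pertMap p Q lam 0 = Q 0 := by simp [pertMap, Pfam, h.prime.ne_zero]
    rw [this]
    exact (h.bound 0 (by simp)).trans_lt (h.C_lt.trans h.rho_lt_one)
  have hEv : ‖pertMap p Q lam v‖ = 1 := by
    rw [h.norm_map hl1 (by rw [hv]; exact hR.rho_lt 1) (by rw [hv]; exact hR.one_lt_one), hv, hpR]
  have hpoly : PolyApprox (closedBall 0 (R 1)) fun z => pertMap p Q lam z :=
    PolyApprox.pertMap h (.const lam) (.id ⟨R 1, fun z hz => hball.1 hz⟩)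
      fun z hz => (hball.1 hz).trans (hR.le_one 1)
  obtain ⟨x, hx, hnear⟩ := hpoly.exists_norm_sub_lt (hball.2 hv.le) (β lam) (by
    rw [sub_eq_add_neg (pertMap p Q lam v), norm_add_eq_left_of_lt (by rwa [norm_neg, hEv]), hEv]
    exact norm_sub_le_of_le_of_le hE0.le hβ1.le) hpM
  have hfx : ‖pertMap p Q lam x‖ = 1 := by
    rw [← hβ1]
    refine norm_eq_of_norm_sub_lt ?_
    rw [hβ1]
    exact hnear.trans (pow_lt_one₀ hi0.le hi1 (by omega))
  have hxR : ‖x‖ = R 1 := by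
    refine (hball.1 hx).eq_of_not_lt fun hlt => ?_
    have h1 := h.norm_map_lt hl1 (hR.rho_lt 1) (hR.le_one 1) hlt
    rw [hpR] at h1
    exact h1.ne hfx
  have h1x : ‖1 - x‖ = 1 := by
    rw [sub_eq_add_neg, norm_add_eq_left_of_lt, norm_one]
    rw [norm_neg, norm_one, hxR]; exact hR.one_lt_one
  have hlam : ∀ mu, ‖mu - lam‖ ≤ (p : ℝ)⁻¹ ^ M → ‖mu - 1‖ < 1 := fun mu hm => by
    rw [← sub_add_sub_cancel mu lam 1]
    exact norm_add_lt_of_lt_of_lt (hm.trans_lt (pow_lt_one₀ hi0.le hi1 (by omega))) hl1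
  have hf1 : ∀ mu, ‖mu - lam‖ ≤ (p : ℝ)⁻¹ ^ M → ‖pertMap p Q mu x‖ = 1 := fun mu hm => by
    rw [h.norm_map (hlam mu hm) (by rw [hxR]; exact hR.rho_lt 1) (by rw [hxR]; exact hR.one_lt_one),
      hxR, hpR]
  have hd : ∀ mu, ‖mu - lam‖ ≤ (p : ℝ)⁻¹ ^ M → ∀ z, ‖z - x‖ ≤ (p : ℝ)⁻¹ ^ (M + 2) →
      ‖pertMap p Q mu z - pertMap p Q mu x‖ ≤ (p : ℝ)⁻¹ ^ (M + 2) := fun mu hm z hz => by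
    have hzR : ‖z‖ ≤ R 1 := by
      rw [← sub_add_cancel z x]
      exact norm_add_le_of_le_of_le (hz.trans (hsq2.trans hsq.le)) hxR.le
    refine (h.norm_map_sub_le_of_rho_lt (hlam mu hm) (hR.rho_lt 1) hR.one_lt_one hzR hxR.le
      (hz.trans hsq2)).trans ?_
    rwa [hpR, one_mul]
  refine ⟨x, hM, hl, hnear.le, ?_, ?_, ?_, hd⟩
  · intro mu nu _ _
    simp only [Function.iterate_one]
    rw [h.norm_map_sub_map, hxR, hpR, h1x, one_mul, mul_one]
  · intro mu hm j hj
    interval_cases j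
    · exact hxR.le.trans (hR.le_one 1)
    · exact (hf1 mu hm).le
  · intro mu hm z hz j hj
    interval_cases j
    · simpa only [Function.iterate_zero, id_eq, hxR] using hz.trans_lt (hsq2.trans_lt hsq)
    · rw [Function.iterate_one, hf1 mu hm]
      exact (hd mu hm z hz).trans_lt (pow_lt_one₀ hi0.le hi1 (by omega))

end Stages

section Wandering

variable {K : Type*} [NontriviallyNormedField K] [IsUltrametricDist K]

/-- The orbit of the disc `closedBall x r` under `f` stays in the unit ball, and it visits smaller
and smaller neighbourhoods of the fixed point `b`: during the `i`-th visit it has norm `1` for `L i`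
steps from time `N i` on and then enters the open unit disc. -/
structure ReturningDisc (f : K → K) (x : K) (r : ℝ) (b : K) (N L : ℕ → ℕ) : Prop where
  fixed : f b = b
  norm_fixed : ‖b‖ = 1
  le_one : ∀ n, ‖f^[n] x‖ ≤ 1
  disc : ∀ z, ‖z - x‖ ≤ r → ∀ n, ‖f^[n] z - f^[n] x‖ < ‖f^[n] x‖
  tendsto : ∀ z, ‖z - x‖ ≤ r → Tendsto (fun i => f^[N i] z) atTop (nhds b)
  tendsto_start : Tendsto N atTop atTop
  tendsto_length : Tendsto L atTop atTop
  eq_one : ∀ i, ∀ j < L i, ‖f^[j + N i] x‖ = 1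
  lt_one : ∀ i, ‖f^[L i + N i] x‖ < 1

namespace ReturningDisc

variable {f : K → K} {x b z w : K} {r : ℝ} {N L : ℕ → ℕ}

lemma norm_eq (hf : ReturningDisc f x r b N L) (hz : ‖z - x‖ ≤ r) (n : ℕ) :
    ‖f^[n] z‖ = ‖f^[n] x‖ :=
  norm_eq_of_norm_sub_lt (hf.disc z hz n)

lemma iterate_ne_of_lt (hf : ReturningDisc f x r b N L) (hz : ‖z - x‖ ≤ r) (hw : ‖w - x‖ ≤ r)
    {m n : ℕ} (hmn : m < n) : f^[m] z ≠ f^[n] w := by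
  intro heq
  obtain ⟨i, hN, hL⟩ := ((hf.tendsto_start.eventually_ge_atTop n).and
    (hf.tendsto_length.eventually_ge_atTop n)).exists
  have h1 : f^[(L i - n + N i) + m] z = f^[(L i - n + N i) + n] w := by
    rw [Function.iterate_add_apply, heq, ← Function.iterate_add_apply]
  have h2 := congrArg norm h1
  rw [hf.norm_eq hz, hf.norm_eq hw, show L i - n + N i + n = L i + N i by omega,
    show L i - n + N i + m = (L i - n + m) + N i by omega, hf.eq_one i _ (by omega)] at h2
  exact (hf.lt_one i).ne' h2

lemma not_tendsto_cycle (hf : ReturningDisc f x r b N L) (hz : ‖z - x‖ ≤ r) {k : ℕ} (hk : 1 ≤ k)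
    {w : K} (hw : f^[k] w = w) :
    ¬ Tendsto (fun n => ⨅ j : Fin k, ‖f^[n] z - f^[(j : ℕ)] w‖) atTop (nhds 0) := by
  intro hlim
  have : Nonempty (Fin k) := ⟨⟨0, hk⟩⟩
  choose j hj using fun n =>
    exists_eq_ciInf_of_finite (f := fun j : Fin k => ‖f^[n] z - f^[(j : ℕ)] w‖)
  simp only [← hj] at hlim
  have hcyc : Tendsto (fun i => f^[(j (N i) : ℕ)] w) atTop (nhds b) := by
    have := (hf.tendsto z hz).sub
      (tendsto_zero_iff_norm_tendsto_zero.2 (hlim.comp hf.tendsto_start))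
    simpa using this
  obtain ⟨i, hi⟩ : b ∈ Set.range fun i : Fin k => f^[(i : ℕ)] w :=
    (Set.finite_range _).isClosed.mem_of_tendsto hcyc (Eventually.of_forall fun _ => ⟨_, rfl⟩)
  have hwb : w = b := by
    rw [← hw, show k = k - i + i by omega, Function.iterate_add_apply]
    exact (congrArg _ hi).trans (Function.iterate_fixed hf.fixed _)
  simp only [hwb, Function.iterate_fixed hf.fixed] at hlim
  have h1 : ∀ i, ‖f^[L i + N i] z - b‖ = 1 := fun i => by
    rw [sub_eq_add_neg, norm_add_eq_right_of_lt, norm_neg, hf.norm_fixed]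
    rw [norm_neg, hf.norm_fixed, hf.norm_eq hz]
    exact hf.lt_one i
  have h2 := hlim.comp
    (tendsto_atTop_mono (fun i => Nat.le_add_right (L i) (N i)) hf.tendsto_length)
  simp only [Function.comp_def, h1] at h2
  exact one_ne_zero (tendsto_nhds_unique tendsto_const_nhds h2)

end ReturningDisc

variable [IsAlgClosed K] [CompleteSpace K]

/-- Parameters for which some disc returns infinitely often to the repelling fixed point are
dense. -/
lemma SmallPert.exists_returningDisc {p : ℕ} {Q : K → K} {C ρ : ℝ} (h : SmallPert p Q C ρ)
    {lam₀ : K} (hl : ‖lam₀ - 1‖ < 1) {ε : ℝ} (hε : 0 < ε) :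
    ∃ lam : K, ‖lam - 1‖ < 1 ∧ ‖lam - lam₀‖ ≤ ε ∧ ∃ (x b : K) (r : ℝ) (N L : ℕ → ℕ), 0 < r ∧
      ReturningDisc (pertMap p Q lam) x r b N L := by
  have hi0 := h.inv_pos
  have hi1 := h.inv_lt_one
  obtain ⟨R, hR⟩ := h.exists_escapeRadii
  obtain ⟨θ, hθ, hlθ, hθ1⟩ : ∃ θ, (p : ℝ)⁻¹ ≤ θ ∧ ‖lam₀ - 1‖ ≤ θ ∧ θ < 1 :=
    ⟨max (p : ℝ)⁻¹ ‖lam₀ - 1‖, le_max_left _ _, le_max_right _ _, max_lt hi1 hl⟩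
  choose! β hβ using fun (lam : K) (hl : ‖lam - 1‖ ≤ θ) => h.exists_fixedPoint hθ hθ1 hl
  have hβ : FixedPoints p Q θ β := ⟨hθ, hθ1, fun _ hl => (hβ _ hl).1, fun _ hl => (hβ _ hl).2⟩
  obtain ⟨M, hMε⟩ := exists_pow_lt_of_lt_one hε hi1
  obtain ⟨x, hs⟩ := h.exists_stage hβ hR hlθ (M := M + 1) (by omega)
  set r := (p : ℝ)⁻¹ ^ (M + 1 + 2)
  choose! N' c' hs' hlt' hc' hesc' using fun n M c (hs : Stage p Q θ β x r n M c) =>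
    hs.exists_next h hβ hR
  let S : ℕ → ℕ × ℕ × K := fun i => i.rec (1, M + 1, lam₀) fun _ s =>
    (N' s.1 s.2.1 s.2.2, s.2.1 + 2, c' s.1 s.2.1 s.2.2)
  let N := fun i => (S i).1
  let L := fun i => (S i).2.1
  let c := fun i => (S i).2.2
  have hL1 : ∀ i, L (i + 1) = L i + 2 := fun i => rfl
  have hS : ∀ i, Stage p Q θ β x r (N i) (L i) (c i) := fun i => by
    induction i with
    | zero => exact hs
    | succ i ih => exact hs' _ _ _ ih
  have hN : ∀ i, N i + L i < N (i + 1) := fun i => hlt' _ _ _ (hS i)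
  have hc : ∀ i, ‖c (i + 1) - c i‖ ≤ (p : ℝ)⁻¹ ^ L i := fun i => hc' _ _ _ (hS i)
  have hesc : ∀ i lam, ‖lam - c (i + 1)‖ ≤ (p : ℝ)⁻¹ ^ L (i + 1) →
    ‖(pertMap p Q lam)^[L i + N i] x‖ < 1 := fun i => hesc' _ _ _ (hS i)
  have hNmono : StrictMono N := strictMono_nat_of_lt_succ fun i => by have := hN i; omega
  have hLmono : StrictMono L := strictMono_nat_of_lt_succ fun i => by have := hL1 i; omega
  have hcauchy : CauchySeq c := by
    refine cauchySeq_of_le_geometric _ 1 hi1 fun i => ?_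
    rw [dist_comm, dist_eq_norm, one_mul]
    exact (hc i).trans (pow_le_pow_of_le_one hi0.le hi1.le (hLmono.id_le i))
  obtain ⟨lam, hlim⟩ := cauchySeq_tendsto_of_complete hcauchy
  have hlam : ∀ i, ‖lam - c i‖ ≤ (p : ℝ)⁻¹ ^ L i := fun i => by
    rw [← dist_eq_norm, ← mem_closedBall]
    refine isClosed_closedBall.mem_of_tendsto hlim (eventually_atTop.2 ⟨i, fun j hj => ?_⟩)
    rw [mem_closedBall, dist_eq_norm]
    induction j, hj using Nat.le_induction with
    | base => rw [sub_self, norm_zero]; exact pow_nonneg hi0.le _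
    | succ j hj ih =>
      exact norm_sub_le_of_sub_le_of_sub_le ((hc j).trans
        (pow_le_pow_of_le_one hi0.le hi1.le (hLmono.monotone hj))) ih
  have hlamθ := (hS 0).norm_sub_one_le h hβ (hlam 0)
  have hnear : ∀ i, ∀ z, ‖z - x‖ ≤ r →
      ‖(pertMap p Q lam)^[N i] z - β lam‖ ≤ (p : ℝ)⁻¹ ^ L i := fun i z hz => by
    refine norm_sub_le_of_sub_le_of_sub_le (((hS i).disc_end lam (hlam i) z hz).trans
      (pow_le_pow_of_le_one hi0.le hi1.le (by omega))) ?_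
    simpa using (hS i).norm_iterate_sub_fixedPoint_le h hβ (hlam i) (j := 0) (i := L i) (by omega)
  refine ⟨lam, hlamθ.trans_lt hθ1, ?_, x, β lam, r, N, L, pow_pos hi0 _, hβ.fixed _ hlamθ,
    h.norm_eq_one_of_sub_one (hβ.near_one _ hlamθ),
    fun n => (hS n).le_one lam (hlam n) n (hNmono.id_le n),
    fun z hz n => (hS n).disc lam (hlam n) z hz n (hNmono.id_le n), fun z hz => ?_,
    hNmono.tendsto_atTop, hLmono.tendsto_atTop,
    fun i j hj => h.norm_eq_one_of_sub_one ((hS i).norm_iterate_sub_one_le h hβ (hlam i) hj),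
    fun i => hesc i lam (hlam (i + 1))⟩
  · exact (hlam 0).trans ((pow_le_pow_of_le_one hi0.le hi1.le (Nat.le_succ M)).trans hMε.le)
  · rw [tendsto_iff_norm_sub_tendsto_zero]
    exact squeeze_zero (fun i => norm_nonneg _) (fun i => hnear i z hz)
      ((tendsto_pow_atTop_nhds_zero_of_lt_one hi0.le hi1).comp hLmono.tendsto_atTop)

end Wandering

/-- For a dense set of parameters `λ ∈ Λ = {|λ − 1| < 1}`, the perturbation
`Q*_λ = P_λ + Q` (with `‖Q‖_B < ρ = p^{-1/(p-1)}`) has a wandering disc contained in its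
filled Julia set relative to `B = {|z| ≤ r̂}` which is not attracted to an attracting cycle.
Here `K` plays the role of `ℂ_p`. -/
theorem statement1 (p : ℕ) (hp : p.Prime)
    {K : Type*} [NontriviallyNormedField K] [IsAlgClosed K] [CompleteSpace K]
    [IsUltrametricDist K] [CharZero K]
    (hpnorm : ‖(p : K)‖ = (p : ℝ)⁻¹)
    (rhat : ℝ) (hrhat : 1 < rhat) (hrhatval : ∃ x : K, x ≠ 0 ∧ ‖x‖ = rhat)
    (a : ℕ → K)
    (hQnorm : ∃ C : ℝ, C < (p : ℝ) ^ (-(1:ℝ) / ((p : ℝ) - 1)) ∧ ∀ i : ℕ, ‖a i‖ * rhat ^ i ≤ C)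
    (lam₀ : K) (hlam₀ : ‖lam₀ - 1‖ < 1) (ε : ℝ) (hε : 0 < ε) :
    ∃ lam : K, ‖lam - 1‖ < 1 ∧ ‖lam - lam₀‖ ≤ ε ∧
      ∃ (c : K) (r : ℝ), 0 < r ∧ closedBall c r ⊆ closedBall (0 : K) rhat ∧
        -- (1) the disc stays in `B` under iteration (it lies in the filled Julia set rel. `B`)
        (∀ z ∈ closedBall c r, ∀ n : ℕ, (Qstar p a lam)^[n] z ∈ closedBall (0 : K) rhat) ∧
        -- (2) the iterated images of the disc are pairwise disjoint
        (∀ m n : ℕ, m ≠ n →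
          ((Qstar p a lam)^[m] '' closedBall c r) ∩ ((Qstar p a lam)^[n] '' closedBall c r) = ∅) ∧
        -- (3) the disc is not attracted to any attracting cycle in `B`
        (∀ k : ℕ, 1 ≤ k → ∀ z₀ ∈ closedBall (0 : K) rhat, (Qstar p a lam)^[k] z₀ = z₀ →
          ‖deriv ((Qstar p a lam)^[k]) z₀‖ < 1 →
          ∀ x ∈ closedBall c r,
            ¬ Tendsto
              (fun n : ℕ => ⨅ j : Fin k, ‖(Qstar p a lam)^[n] x - (Qstar p a lam)^[(j : ℕ)] z₀‖)
              atTop (nhds 0)) := by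
  obtain ⟨C, hC, ha⟩ := hQnorm
  obtain ⟨lam, hlam, hlε, x, b, r, N, L, hr, hf⟩ :=
    (smallPert_Qser hp hpnorm hrhat hC ha).exists_returningDisc hlam₀ hε
  have hball : ∀ z ∈ closedBall x r, ‖z - x‖ ≤ r := fun z hz => by
    rwa [← dist_eq_norm, ← mem_closedBall]
  have hJulia : ∀ z ∈ closedBall x r, ∀ n, (Qstar p a lam)^[n] z ∈ closedBall (0 : K) rhat :=
    fun z hz n => by
      rw [mem_closedBall_zero_iff]
      exact ((hf.norm_eq (hball z hz) n).trans_le (hf.le_one n)).trans hrhat.le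
  refine ⟨lam, hlam, hlε, x, r, hr, fun z hz => hJulia z hz 0, hJulia, fun m n hmn => ?_,
    fun k hk z₀ _ hz₀ _ z hz => hf.not_tendsto_cycle (hball z hz) hk hz₀⟩
  rw [← Set.disjoint_iff_inter_eq_empty, Set.disjoint_left]
  rintro _ ⟨z, hz, rfl⟩ ⟨w, hw, heq⟩
  rcases hmn.lt_or_gt with hlt | hlt
  · exact hf.iterate_ne_of_lt (hball z hz) (hball w hw) hlt heq.symm
  · exact hf.iterate_ne_of_lt (hball w hw) (hball z hz) hlt heq
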